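/- arXiv:1405.4993 — 4 statements merged into one kernel-verified Lean document; each statement's English description precedes it below -/
import Mathlib

section
/- Let K be a convex body in ℝ^2 with centroid at the origin and let Λ be a lattice of rank 2 in ℝ^2. Then vol(K)/det Λ ≤ (9/2)·(1/λ_1(K,Λ))·(1/λ_2(K,Λ)). For Λ = ℤ^2, equality is attained by the triangle T_2 = −(1,1) + 3·conv{0, e_1, e_2}. -/
open MeasureTheory Set Filter Pointwise RealInnerProductSpace
open scoped ENNReal

noncomputable section

namespace Paper

/-- Euclidean space `ℝ^n`. -/
abbrev Euc (n : ℕ) := EuclideanSpace ℝ (Fin n)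

variable {n : ℕ}

/-- A convex body: a compact convex set with non-empty interior. -/
def IsConvexBody (K : Set (Euc n)) : Prop :=
  Convex ℝ K ∧ IsCompact K ∧ (interior K).Nonempty

/-- The centroid of `K` lies at the origin, i.e. `∫_K x dx = 0`. -/
def CentroidAtOrigin (K : Set (Euc n)) : Prop :=
  (∫ x in K, x) = (0 : Euc n)

/-- The lattice generated by the family `b`. -/
def latticeOf (b : Fin n → Euc n) : Set (Euc n) :=
  {x | ∃ z : Fin n → ℤ, x = ∑ i, (z i : ℝ) • b i}

/-- The determinant of the lattice generated by `b`. -/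
def latticeDet (b : Fin n → Euc n) : ℝ :=
  |Matrix.det (Matrix.of fun i j => b j i)|

/-- The integer lattice `ℤ^n` inside `ℝ^n`. -/
def stdLattice (n : ℕ) : Set (Euc n) :=
  {x | ∀ i, ∃ m : ℤ, x i = (m : ℝ)}

/-- `succMin K Λ i` is the `i`-th successive minimum
`λ_i(K,Λ) = inf {t > 0 : t•K contains at least i linearly independent points of Λ}`. -/
def succMin (K Λ : Set (Euc n)) (i : ℕ) : ℝ :=
  sInf {t : ℝ | 0 < t ∧ ∃ v : Fin i → Euc n,
    LinearIndependent ℝ v ∧ ∀ j, v j ∈ Λ ∧ v j ∈ t • K}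

/-- Surface area of a convex body, via the (outer) Minkowski content. -/
def surfaceArea (K : Set (Euc n)) : ℝ :=
  limUnder (nhdsWithin (0 : ℝ) (Ioi 0)) fun ε =>
    ((volume (Metric.cthickening ε K)).toReal - (volume K).toReal) / ε

/-- The `k`-th elementary symmetric function of `ρ 0, …, ρ (n-1)`. -/
def esym (n k : ℕ) (ρ : Fin n → ℝ) : ℝ :=
  ∑ J ∈ Finset.powersetCard k (Finset.univ : Finset (Fin n)), ∏ i ∈ J, ρ i

/-- A rational polytope: convex hull of finitely many points with rational coordinates. -/
def IsRationalPolytope (P : Set (Euc n)) : Prop :=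
  ∃ V : Finset (Euc n), (∀ v ∈ V, ∀ i, ∃ q : ℚ, v i = (q : ℝ)) ∧
    P = convexHull ℝ (V : Set (Euc n))

/-- A lattice polytope: convex hull of finitely many points of `ℤ^n`. -/
def IsLatticePolytope (P : Set (Euc n)) : Prop :=
  ∃ V : Finset (Euc n), (∀ v ∈ V, v ∈ stdLattice n) ∧
    P = convexHull ℝ (V : Set (Euc n))

/-- `F` is a facet of `P`: an `(n-1)`-dimensional face cut out by a supporting hyperplane. -/
def IsFacet (P F : Set (Euc n)) : Prop :=
  ∃ (a : Euc n) (b : ℝ), a ≠ 0 ∧ (∀ x ∈ P, ⟪a, x⟫ ≤ b) ∧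
    F = {x | x ∈ P ∧ ⟪a, x⟫ = b} ∧
    Module.finrank ℝ (affineSpan ℝ F).direction = n - 1

/-- The determinant of a `k`-dimensional lattice `L ⊆ ℝ^n` (given as a set of points):
the square root of the Gram determinant of any ℤ-basis of `L`. -/
def sublatticeDetOf (k : ℕ) (L : Set (Euc n)) : ℝ :=
  sInf {d : ℝ | ∃ c : Fin k → Euc n, LinearIndependent ℝ c ∧
    L = {x | ∃ z : Fin k → ℤ, x = ∑ i, (z i : ℝ) • c i} ∧
    d = Real.sqrt (Matrix.det (Matrix.of fun i j => ⟪c i, c j⟫))}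

/-- The lattice surface area
`lE_{n-1}(P) = (1/2) ∑_{F facet of P} vol_{n-1}(F) / det(aff₀(F) ∩ ℤ^n)`,
where `vol_{n-1}` is realized by the `(n-1)`-dimensional Hausdorff measure. -/
def latticeSurfaceArea (P : Set (Euc n)) : ℝ :=
  (1/2) * ∑ᶠ F ∈ {F : Set (Euc n) | IsFacet P F},
    (μH[(n : ℝ) - 1] F).toReal /
      sublatticeDetOf (n - 1) (((affineSpan ℝ F).direction : Set (Euc n)) ∩ stdLattice n)

/-- `D_i(Λ)`: the minimal determinant of an `i`-dimensional sublattice of `Λ`. -/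
def minSublatticeDet (Λ : Set (Euc n)) (i : ℕ) : ℝ :=
  sInf {d : ℝ | ∃ c : Fin i → Euc n, LinearIndependent ℝ c ∧ (∀ j, c j ∈ Λ) ∧
    d = Real.sqrt (Matrix.det (Matrix.of fun k l => ⟪c k, c l⟫))}

/-- `D_min(Λ) = min {D_i(Λ)^(1/i) : 1 ≤ i ≤ n}`. -/
def Dmin (Λ : Set (Euc n)) : ℝ :=
  sInf {d : ℝ | ∃ i : Fin n, d = minSublatticeDet Λ ((i : ℕ) + 1) ^ ((1 : ℝ) / ((i : ℕ) + 1))}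

/-- The polar lattice `Λ^⋆ = {x : ⟨x,y⟩ ∈ ℤ for all y ∈ Λ}`. -/
def polarLattice (Λ : Set (Euc n)) : Set (Euc n) :=
  {x | ∀ y ∈ Λ, ∃ m : ℤ, ⟪x, y⟫ = (m : ℝ)}

/-- The standard cross-polytope `C_n^⋆ = conv{±e_1, …, ±e_n}`. -/
def crossPolytope (n : ℕ) : Set (Euc n) :=
  convexHull ℝ ((Set.range fun i : Fin n => EuclideanSpace.single i (1 : ℝ)) ∪
    (Set.range fun i : Fin n => -EuclideanSpace.single i (1 : ℝ)))

/-- The standard simplex `S_n = conv{0, e_1, …, e_n}`. -/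
def stdSimplexSet (n : ℕ) : Set (Euc n) :=
  convexHull ℝ (insert 0 (Set.range fun i : Fin n => EuclideanSpace.single i (1 : ℝ)))

/-- The all-ones vector `𝟙 = (1,…,1)`. -/
def allOnes (n : ℕ) : Euc n := WithLp.toLp 2 fun _ => (1 : ℝ)

/-- The simplex `T_n = -𝟙 + (n+1) S_n`. -/
def Tn (n : ℕ) : Set (Euc n) :=
  (fun x => ((n : ℝ) + 1) • x - allOnes n) '' stdSimplexSet n


/-- slice length -/
def sl (K : Set (ℝ × ℝ)) (y : ℝ) : ℝ := volume.real {x : ℝ | (x, y) ∈ K}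

lemma sl_nonneg (K : Set (ℝ × ℝ)) (y : ℝ) : 0 ≤ sl K y := measureReal_nonneg

lemma slice_compact {K : Set (ℝ × ℝ)} (hc : IsCompact K) (y : ℝ) :
    IsCompact {x : ℝ | (x, y) ∈ K} := by
  have h1 : IsCompact (Prod.fst '' (K ∩ {p | p.2 = y})) := by
    apply IsCompact.image _ continuous_fst
    apply hc.inter_right
    exact isClosed_eq continuous_snd continuous_const
  convert h1 using 1
  ext x
  constructor
  · intro h
    exact ⟨(x, y), ⟨h, rfl⟩, rfl⟩
  · rintro ⟨⟨a, b⟩, ⟨h, h2⟩, h3⟩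
    simp only [mem_ofPred_eq] at h2 h3 ⊢
    subst h2 h3
    exact h

lemma slice_convex {K : Set (ℝ × ℝ)} (hK : Convex ℝ K) (y : ℝ) :
    Convex ℝ {x : ℝ | (x, y) ∈ K} := by
  intro a ha b hb s t hs ht hst
  have := hK ha hb hs ht hst
  simp only [mem_ofPred_eq] at *
  convert this using 1
  ext <;> simp
  rw [← add_mul, hst, one_mul]

lemma sl_concave {K : Set (ℝ × ℝ)} (hK : Convex ℝ K) (hc : IsCompact K) {y₁ y₂ s t : ℝ}
    (h₁ : {x : ℝ | (x, y₁) ∈ K}.Nonempty) (h₂ : {x : ℝ | (x, y₂) ∈ K}.Nonempty)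
    (hs : 0 ≤ s) (ht : 0 ≤ t) (hst : s + t = 1) :
    s * sl K y₁ + t * sl K y₂ ≤ sl K (s * y₁ + t * y₂) := by
  have e₁ := eq_Icc_of_connected_compact ⟨h₁, (slice_convex hK y₁).isPreconnected⟩ (slice_compact hc y₁)
  have e₂ := eq_Icc_of_connected_compact ⟨h₂, (slice_convex hK y₂).isPreconnected⟩ (slice_compact hc y₂)
  set l₁ := sInf {x : ℝ | (x, y₁) ∈ K}
  set r₁ := sSup {x : ℝ | (x, y₁) ∈ K}
  set l₂ := sInf {x : ℝ | (x, y₂) ∈ K}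
  set r₂ := sSup {x : ℝ | (x, y₂) ∈ K}
  have o₁ : l₁ ≤ r₁ := by
    rw [e₁] at h₁; exact nonempty_Icc.1 h₁
  have o₂ : l₂ ≤ r₂ := by
    rw [e₂] at h₂; exact nonempty_Icc.1 h₂
  have m1 : (l₁, y₁) ∈ K := by
    have : l₁ ∈ {x : ℝ | (x, y₁) ∈ K} := by rw [e₁]; exact left_mem_Icc.2 o₁
    exact this
  have m2 : (r₁, y₁) ∈ K := by
    have : r₁ ∈ {x : ℝ | (x, y₁) ∈ K} := by rw [e₁]; exact right_mem_Icc.2 o₁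
    exact this
  have m3 : (l₂, y₂) ∈ K := by
    have : l₂ ∈ {x : ℝ | (x, y₂) ∈ K} := by rw [e₂]; exact left_mem_Icc.2 o₂
    exact this
  have m4 : (r₂, y₂) ∈ K := by
    have : r₂ ∈ {x : ℝ | (x, y₂) ∈ K} := by rw [e₂]; exact right_mem_Icc.2 o₂
    exact this
  have f1 : sl K y₁ = r₁ - l₁ := by
    unfold sl; rw [e₁, Real.volume_real_Icc_of_le o₁]
  have f2 : sl K y₂ = r₂ - l₂ := by
    unfold sl; rw [e₂, Real.volume_real_Icc_of_le o₂]
  have a1 : s * l₁ + t * l₂ ∈ {x : ℝ | (x, s * y₁ + t * y₂) ∈ K} := by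
    have := hK m1 m3 hs ht hst
    simpa using this
  have a2 : s * r₁ + t * r₂ ∈ {x : ℝ | (x, s * y₁ + t * y₂) ∈ K} := by
    have := hK m2 m4 hs ht hst
    simpa using this
  have sub : Icc (s * l₁ + t * l₂) (s * r₁ + t * r₂) ⊆ {x : ℝ | (x, s * y₁ + t * y₂) ∈ K} :=
    (slice_convex hK _).ordConnected.out a1 a2
  have := measureReal_mono (μ := volume) sub (slice_compact hc _).measure_lt_top.ne
  rw [Real.volume_real_Icc_of_le (by gcongr)] at this
  rw [f1, f2]
  unfold sl
  nlinarith

lemma fubini {K : Set (ℝ × ℝ)} (hc : IsCompact K) {g : ℝ → ℝ} (hg : Continuous g) :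
    Integrable (fun y => g y * sl K y) ∧ ∫ p in K, g p.2 = ∫ y, g y * sl K y := by
  have hi : Integrable (K.indicator (fun p : ℝ × ℝ => g p.2)) (volume.prod volume) := by
    rw [← Measure.volume_eq_prod, integrable_indicator_iff hc.measurableSet]
    exact (hg.comp continuous_snd).continuousOn.integrableOn_compact hc
  have key : ∀ y, ∫ x : ℝ, K.indicator (fun p : ℝ × ℝ => g p.2) (x, y) = g y * sl K y := by
    intro y
    have : (fun x : ℝ => K.indicator (fun p : ℝ × ℝ => g p.2) (x, y))
        = {x : ℝ | (x, y) ∈ K}.indicator (fun _ => g y) := by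
      ext x
      by_cases h : (x, y) ∈ K
      · simp [indicator, h]
      · simp [indicator, h]
    rw [this, integral_indicator (slice_compact hc y).measurableSet]
    simp [sl, mul_comm]
  constructor
  · have := hi.integral_prod_right
    simpa only [key] using this
  · rw [← integral_indicator hc.measurableSet, Measure.volume_eq_prod, integral_prod_symm _ hi]
    simp only [key]

lemma grunbaum {K : Set (ℝ × ℝ)} (hK : Convex ℝ K) (hc : IsCompact K)
    (h0 : 0 < sl K 0) (hcen : ∫ p in K, p.2 = 0)
    (hA0 : 0 < volume.real (K ∩ {p | 0 ≤ p.2})) :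
    volume.real K ≤ 9 / 4 * volume.real (K ∩ {p | 0 ≤ p.2}) := by
  set f := sl K with hf
  set s := f 0 with hs
  set A := volume.real (K ∩ {p | 0 ≤ p.2}) with hA
  have hCc : IsCompact (K ∩ {p | 0 ≤ p.2}) :=
    hc.inter_right (isClosed_le continuous_const continuous_snd)
  have hfC : ∀ y, sl (K ∩ {p | 0 ≤ p.2}) y = if 0 ≤ y then f y else 0 := by
    intro y
    unfold sl
    split_ifs with h
    · simp [hf, h, sl]
    · simp [h]
  have I1 : Integrable f := by simpa using (fubini hc (continuous_const (y := (1:ℝ)))).1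
  have V1 : volume.real K = ∫ y, f y := by
    simpa using (fubini hc (continuous_const (y := (1:ℝ)))).2
  have I2 : Integrable (fun y => y * f y) := (fubini hc continuous_id).1
  have V2 : ∫ y, y * f y = 0 := by
    rw [← hcen]; exact (fubini hc continuous_id).2.symm
  have I3 : Integrable (fun y => if 0 ≤ y then f y else 0) := by
    simpa [hfC] using (fubini hCc (continuous_const (y := (1:ℝ)))).1
  have V3 : A = ∫ y, if 0 ≤ y then f y else 0 := by
    simpa [hfC] using (fubini hCc (continuous_const (y := (1:ℝ)))).2
  set h := 2 * A / s with hh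
  have hpos : 0 < h := by positivity
  set t : ℝ → ℝ := fun y => s * (1 - y / h) with ht
  set T : ℝ → ℝ := (Icc (-(h/2)) h).indicator t with hT
  have ct : Continuous t := by fun_prop
  have J1 : Integrable T := by
    rw [hT, integrable_indicator_iff measurableSet_Icc]
    exact ct.continuousOn.integrableOn_compact isCompact_Icc
  have J2 : Integrable (fun y => y * T y) := by
    have : (fun y => y * T y) = (Icc (-(h/2)) h).indicator (fun y => y * t y) := by
      ext y; simp [hT, indicator]
    rw [this, integrable_indicator_iff measurableSet_Icc]
    exact (continuous_id.mul ct).continuousOn.integrableOn_compact isCompact_Icc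
  have hTC : (fun y => if 0 ≤ y then T y else 0) = (Icc 0 h).indicator t := by
    ext y
    simp only [hT, indicator, mem_Icc]
    by_cases h1 : 0 ≤ y
    · by_cases h2 : y ≤ h
      · have : -(h/2) ≤ y := by linarith
        simp [h1, h2, this]
      · simp [h2]
    · simp [h1]
  have J3 : Integrable (fun y => if 0 ≤ y then T y else 0) := by
    rw [hTC, integrable_indicator_iff measurableSet_Icc]
    exact ct.continuousOn.integrableOn_compact isCompact_Icc
  have anti : ∀ a b : ℝ, ∫ y in a..b, t y = s * ((b - a) - (b^2 - a^2) / 2 / h) := by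
    intro a b
    simp only [ht]
    rw [intervalIntegral.integral_const_mul, intervalIntegral.integral_sub (by simp) (by
      apply Continuous.intervalIntegrable; fun_prop)]
    rw [intervalIntegral.integral_div]
    simp
  have W1 : ∫ y, T y = 9 / 4 * A := by
    rw [hT, integral_indicator measurableSet_Icc, integral_Icc_eq_integral_Ioc,
      ← intervalIntegral.integral_of_le (by linarith), anti]
    have : A = s * h / 2 := by rw [hh]; field_simp
    rw [this]; field_simp; ring
  have W3 : ∫ y, (if 0 ≤ y then T y else 0) = A := by
    rw [hTC, integral_indicator measurableSet_Icc, integral_Icc_eq_integral_Ioc,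
      ← intervalIntegral.integral_of_le (by linarith), anti]
    have : A = s * h / 2 := by rw [hh]; field_simp
    rw [this]; field_simp; ring
  have W2 : ∫ y, y * T y = 0 := by
    have : (fun y => y * T y) = (Icc (-(h/2)) h).indicator (fun y => y * t y) := by
      ext y; simp [hT, indicator]
    rw [this, integral_indicator measurableSet_Icc, integral_Icc_eq_integral_Ioc,
      ← intervalIntegral.integral_of_le (by linarith)]
    have : (fun y => y * t y) = fun y => s * (y - y^2 / h) := by
      ext y; simp only [ht]; ring
    rw [this, intervalIntegral.integral_const_mul, intervalIntegral.integral_sub (by simp) (by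
      apply Continuous.intervalIntegrable; fun_prop), intervalIntegral.integral_div]
    simp
    right
    field_simp; ring
  have fnn : ∀ y, 0 ≤ f y := fun y => sl_nonneg K y
  have ne_of : ∀ y, 0 < f y → {x : ℝ | (x, y) ∈ K}.Nonempty := by
    intro y hy
    by_contra hne
    rw [not_nonempty_iff_eq_empty] at hne
    simp [hf, sl, hne] at hy
  have ne0 := ne_of 0 h0
  have conc : ∀ y y', 0 < y → y < y' → 0 < f y' → t y' ≤ f y' → t y ≤ f y := by
    intro y y' hy hyy hp hty
    have hy' : 0 < y' := hy.trans hyy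
    have := sl_concave hK hc ne0 (ne_of y' hp) (s := 1 - y / y') (t := y / y')
      (by rw [sub_nonneg, div_le_one hy']; exact hyy.le) (by positivity) (by ring)
    have e : (1 - y / y') * 0 + y / y' * y' = y := by field_simp; ring
    rw [e] at this
    have e2 : t y = (1 - y / y') * s + y / y' * t y' := by
      simp only [ht]; field_simp; ring
    rw [e2]
    have : y / y' * t y' ≤ y / y' * f y' := by gcongr
    linarith
  have Tnn : ∀ y, 0 ≤ T y := by
    intro y
    apply indicator_nonneg
    intro y hy
    have : y / h ≤ 1 := by rw [div_le_one hpos]; exact hy.2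
    simp only [ht]
    apply mul_nonneg h0.le; linarith
  have tneg : ∀ y, h ≤ y → t y ≤ 0 := by
    intro y hy
    have : 1 ≤ y / h := by rw [one_le_div hpos]; exact hy
    simp only [ht]
    nlinarith
  have Tin : ∀ y, -(h/2) ≤ y → y ≤ h → T y = t y := by
    intro y h1 h2
    simp [hT, indicator, h1, h2]
  have Tout : ∀ y, h < y → T y = 0 := by
    intro y h1
    simp [hT, indicator, h1]
  have Tout' : ∀ y, y < -(h/2) → T y = 0 := by
    intro y h1
    simp [hT, indicator, h1]
  -- lower part
  have low : ∀ y, y < 0 → f y ≤ t y := by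
    intro y₁ hy₁
    by_contra hlt
    push Not at hlt
    have tp : 0 < t y₁ := by
      simp only [ht]
      have : y₁ / h < 0 := div_neg_of_neg_of_pos hy₁ hpos
      apply mul_pos h0; linarith
    have key : ∀ y, 0 < y → {x : ℝ | (x, y) ∈ K}.Nonempty → f y < t y := by
      intro y hy hne
      have hd : 0 < y - y₁ := by linarith
      have := sl_concave hK hc (ne_of y₁ (tp.trans hlt)) hne (s := y / (y - y₁)) (t := (-y₁) / (y - y₁))
        (by positivity) (by apply div_nonneg; linarith; linarith) (by field_simp; ring)
      have e : y / (y - y₁) * y₁ + (-y₁) / (y - y₁) * y = 0 := by field_simp; ring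
      rw [e] at this
      have e2 : s = y / (y - y₁) * t y₁ + (-y₁) / (y - y₁) * t y := by
        simp only [ht]; field_simp; ring
      have q1 : y / (y - y₁) * t y₁ < y / (y - y₁) * f y₁ := by
        apply mul_lt_mul_of_pos_left hlt; positivity
      have q2 : (-y₁) / (y - y₁) * f y < (-y₁) / (y - y₁) * t y := by
        have : sl K 0 = s := rfl
        linarith
      exact lt_of_mul_lt_mul_left q2 (by apply div_nonneg; linarith; linarith)
    have key2 : ∀ y, 0 < y → y < h → f y < T y := by
      intro y h1 h2
      rw [Tin y (by linarith) h2.le]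
      by_cases hne : {x : ℝ | (x, y) ∈ K}.Nonempty
      · exact key y h1 hne
      · rw [not_nonempty_iff_eq_empty] at hne
        have : f y = 0 := by simp [hf, sl, hne]
        rw [this]
        simp only [ht]
        have : y / h < 1 := by rw [div_lt_one hpos]; exact h2
        apply mul_pos h0; linarith
    have key3 : ∀ y, h ≤ y → f y = 0 := by
      intro y h1
      by_contra hne
      have hp : 0 < f y := lt_of_le_of_ne (fnn y) (Ne.symm hne)
      have := key y (by linarith) (ne_of y hp)
      have := tneg y h1
      linarith
    have z : ∫ y, ((if 0 ≤ y then T y else 0) - (if 0 ≤ y then f y else 0)) = 0 := by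
      rw [integral_sub J3 I3, W3, ← V3, sub_self]
    have nn : 0 ≤ fun y => ((if 0 ≤ y then T y else 0) - (if 0 ≤ y then f y else 0)) := by
      intro y
      simp only [Pi.zero_apply, sub_nonneg]
      split_ifs with hy
      · rcases hy.eq_or_lt with rfl | hy
        · rw [Tin 0 (by linarith) hpos.le]; simp [ht, hs]
        · rcases lt_or_ge y h with h2 | h2
          · exact (key2 y hy h2).le
          · rw [key3 y h2]; exact Tnn y
      · exact le_rfl
    have := (integral_pos_iff_support_of_nonneg nn (J3.sub I3)).2 (by
      have sub : Ioo 0 h ⊆ Function.support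
          (fun y => ((if 0 ≤ y then T y else 0) - (if 0 ≤ y then f y else 0))) := by
        intro y hy
        have := key2 y hy.1 hy.2
        simp only [Function.mem_support, hy.1.le, if_true]
        linarith
      refine lt_of_lt_of_le ?_ (measure_mono sub)
      simp [hpos])
    linarith
  -- crossing point
  obtain ⟨c, hc1, hc2, hc3⟩ : ∃ c : ℝ, 0 ≤ c ∧ (∀ y, 0 < y → y < c → T y ≤ f y) ∧
      (∀ y, c < y → f y ≤ T y) := by
    set Z : Set ℝ := {y | 0 ≤ y ∧ 0 < f y ∧ t y ≤ f y} with hZ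
    have z0 : (0:ℝ) ∈ Z := ⟨le_rfl, h0, by simp [ht, hs]⟩
    have zb : BddAbove Z := by
      obtain ⟨R, hR⟩ := hc.isBounded.subset_closedBall (0 : ℝ × ℝ)
      refine ⟨R, ?_⟩
      rintro y ⟨_, h2, _⟩
      obtain ⟨x, hx⟩ := ne_of y h2
      have := hR hx
      rw [mem_closedBall_zero_iff] at this
      have h3 := norm_snd_le (x, y)
      exact (le_abs_self y).trans (h3.trans this)
    refine ⟨sSup Z, le_csSup zb z0, ?_, ?_⟩
    · intro y hy hyc
      obtain ⟨y', hy', hlt⟩ := exists_lt_of_lt_csSup ⟨0, z0⟩ hyc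
      have := conc y y' hy hlt hy'.2.1 hy'.2.2
      rcases le_or_gt y h with h1 | h1
      · rw [Tin y (by linarith) h1]; exact this
      · rw [Tout y h1]; exact fnn y
    · intro y hy
      by_contra hlt
      push Not at hlt
      have y0 : 0 < y := lt_of_le_of_lt (le_csSup zb z0) hy
      have fp : 0 < f y := lt_of_le_of_lt (Tnn y) hlt
      have : y ∈ Z := by
        refine ⟨y0.le, fp, ?_⟩
        rcases le_or_gt y h with h1 | h1
        · rw [← Tin y (by linarith) h1]; exact hlt.le
        · exact (tneg y h1.le).trans fp.le
      exact absurd (le_csSup zb this) (not_le.2 hy)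
  have main : ∀ y, y * f y + h/2 * f y ≤ y * T y + h/2 * T y +
      (c + h/2) * ((if 0 ≤ y then f y else 0) - (if 0 ≤ y then T y else 0)) := by
    intro y
    by_cases hy : 0 ≤ y
    · simp only [hy, if_true]
      suffices (y - c) * (f y - T y) ≤ 0 by nlinarith
      rcases hy.eq_or_lt with rfl | hy
      · rw [Tin 0 (by linarith) hpos.le]; simp [ht, hs]
      rcases lt_trichotomy y c with h1 | h1 | h1
      · exact mul_nonpos_of_nonpos_of_nonneg (by linarith) (by linarith [hc2 y hy h1])
      · simp [h1]
      · exact mul_nonpos_of_nonneg_of_nonpos (by linarith) (by linarith [hc3 y h1])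
    · simp only [hy, if_false]
      push Not at hy
      suffices (y + h/2) * (f y - T y) ≤ 0 by nlinarith
      rcases lt_or_ge y (-(h/2)) with h1 | h1
      · rw [Tout' y h1]
        exact mul_nonpos_of_nonpos_of_nonneg (by linarith) (by linarith [fnn y])
      · rw [Tin y h1 (by linarith)]
        exact mul_nonpos_of_nonneg_of_nonpos (by linarith) (by linarith [low y hy])
  have X1 : Integrable (fun y => y * T y + h/2 * T y) := J2.add (J1.const_mul (h/2))
  have X2 : Integrable (fun y => (c + h/2) *
      ((if 0 ≤ y then f y else 0) - (if 0 ≤ y then T y else 0))) := (I3.sub J3).const_mul (c + h/2)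
  have fin := integral_mono (I2.add (I1.const_mul (h/2))) (X1.add X2) main
  simp only [Pi.add_apply] at fin
  rw [integral_add I2 (I1.const_mul (h/2)), integral_const_mul, V2,
    integral_add X1 X2, integral_const_mul, integral_add J2 (J1.const_mul (h/2)),
    integral_sub I3 J3, integral_const_mul, W1, W2, W3, ← V3, ← V1] at fin
  nlinarith

lemma latticeDet_two (b : Fin 2 → Euc 2) :
    latticeDet b = |b 0 0 * b 1 1 - b 1 0 * b 0 1| := by
  simp [latticeDet, Matrix.det_fin_two]

lemma mink1 (c : Fin 2 → Euc 2) (hc : LinearIndependent ℝ c) (S : Set (Euc 2))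
    (hS : Convex ℝ S) (hsym : ∀ x ∈ S, -x ∈ S)
    (hno : ∀ m j : ℤ, (m : ℝ) • c 0 + (j : ℝ) • c 1 ∈ S → m = 0 ∧ j = 0) :
    volume S ≤ ENNReal.ofReal (latticeDet c) * 4 := by
  let B : Module.Basis (Fin 2) ℝ (Euc 2) := basisOfLinearIndependentOfCardEqFinrank hc (by simp)
  have hB : (B : Fin 2 → Euc 2) = c := by simp [B]
  by_contra hlt
  push Not at hlt
  have fund := ZSpan.isAddFundamentalDomain' B (volume : Measure (Euc 2))
  have hvol : (volume : Measure (Euc 2)) (ZSpan.fundamentalDomain B)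
      = ENNReal.ofReal (latticeDet c) := by
    rw [ZSpan.measure_fundamentalDomain B volume (EuclideanSpace.basisFun (Fin 2) ℝ).toBasis,
      measure_congr (ZSpan.fundamentalDomain_ae_parallelepiped _ volume)]
    have : volume (parallelepiped ((EuclideanSpace.basisFun (Fin 2) ℝ).toBasis)) = 1 := by
      rw [OrthonormalBasis.coe_toBasis]
      exact OrthonormalBasis.volume_parallelepiped _
    rw [this, mul_one, hB]
    congr 1
  have : Countable (Submodule.span ℤ (Set.range B)).toAddSubgroup :=
    inferInstanceAs (Countable (Submodule.span ℤ (Set.range B)))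
  obtain ⟨x, hx0, hxS⟩ := exists_ne_zero_mem_lattice_of_measure_mul_two_pow_lt_measure fund hsym hS
    (by
      rw [hvol]
      have e : Module.finrank ℝ (Euc 2) = 2 := by simp
      rw [e]
      norm_num
      exact hlt)
  obtain ⟨x, hx⟩ := x
  have hx' : x ∈ Submodule.span ℤ (Set.range B) := hx
  rw [Submodule.mem_span_range_iff_exists_fun] at hx'
  obtain ⟨z, hz⟩ := hx'
  rw [hB, Fin.sum_univ_two] at hz
  have hxe : x = (z 0 : ℝ) • c 0 + (z 1 : ℝ) • c 1 := by
    rw [← hz]; simp only [Int.cast_smul_eq_zsmul]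
  have h := hno (z 0) (z 1) (by rw [← hxe]; exact hxS)
  apply hx0
  ext1
  show x = 0
  rw [hxe, h.1, h.2]; simp

lemma slice_k (T : Set (Euc 2)) (hT : Convex ℝ T) (v w : Euc 2)
    (hno : ∀ a : ℤ, (a : ℝ) • v + w ∉ T) :
    ∃ k : ℤ, ∀ x : ℝ, x • v + w ∈ T → (k : ℝ) < x ∧ x < k + 1 := by
  by_cases hne : ∃ x₀ : ℝ, x₀ • v + w ∈ T
  · obtain ⟨x₀, hx₀⟩ := hne
    have hcv : Convex ℝ {x : ℝ | x • v + w ∈ T} := by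
      intro a ha b hb s t hs ht hst
      have := hT ha hb hs ht hst
      simp only [mem_ofPred_eq] at *
      convert this using 1
      rw [smul_add, smul_add, smul_smul, smul_smul, smul_eq_mul, smul_eq_mul]
      have : w = s • w + t • w := by rw [← add_smul, hst, one_smul]
      nth_rewrite 1 [this]
      module
    refine ⟨⌊x₀⌋, fun x hx => ⟨?_, ?_⟩⟩
    · by_contra h
      push Not at h
      exact hno ⌊x₀⌋ (hcv.ordConnected.out hx hx₀ ⟨h, Int.floor_le _⟩)
    · by_contra h
      push Not at h
      refine hno (⌊x₀⌋ + 1) (hcv.ordConnected.out hx₀ hx ⟨?_, ?_⟩)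
      · push_cast; exact (Int.lt_floor_add_one _).le
      · push_cast; exact h
  · push Not at hne
    exact ⟨0, fun x hx => absurd hx (hne x)⟩

lemma vol_interior {T : Set (Euc 2)} (hT : Convex ℝ T) : volume (interior T) = volume T :=
  measure_congr (interior_ae_eq_of_null_frontier (hT.addHaar_frontier volume))

lemma neg_mem_interior {T : Set (Euc 2)} (hsym : ∀ x ∈ T, -x ∈ T) {x : Euc 2}
    (hx : x ∈ interior T) : -x ∈ interior T := by
  have hneg : T = (Homeomorph.neg (Euc 2)) ⁻¹' T := by
    ext y
    constructor
    · intro hy; exact hsym _ hy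
    · intro hy; simpa using hsym _ hy
  rw [hneg, ← (Homeomorph.neg (Euc 2)).preimage_interior T]
  simpa using hx

lemma mink2a (T : Set (Euc 2)) (hT : Convex ℝ T) (hsym : ∀ x ∈ T, -x ∈ T)
    (v w : Euc 2) (hvw : LinearIndependent ℝ ![v, w]) (L : ℝ) (hL : 1 ≤ L) (hLv : L • v ∈ T)
    (hmax : ∀ x : ℝ, x • v ∈ T → x ≤ L)
    (hno : ∀ a j : ℤ, j ≠ 0 → (a : ℝ) • v + (j : ℝ) • w ∉ T) :
    volume T ≤ ENNReal.ofReal (L * latticeDet ![v, w]) * 4 := by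
  obtain ⟨k, hk⟩ := slice_k T hT v w (fun a ha => hno a 1 one_ne_zero (by simpa using ha))
  have h0 : (0 : Euc 2) ∈ T := by
    have := hT hLv (hsym _ hLv) (a := 1/2) (b := 1/2) (by norm_num) (by norm_num) (by norm_num)
    simpa using this
  have hscale : ∀ x ∈ T, ∀ r : ℝ, 0 ≤ r → r ≤ 1 → r • x ∈ T := fun x hx r h1 h2 => by
    have := hT hx h0 h1 (sub_nonneg.2 h2) (by ring)
    simpa using this
  have hpi := LinearIndependent.pair_iff.1 hvw
  have hli : LinearIndependent ℝ ![L • v, (k : ℝ) • v + w] := by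
    rw [LinearIndependent.pair_iff]
    intro s t hst
    have := hpi (s * L + t * k) t (by rw [← hst]; module)
    have ht := this.2
    have h2 := this.1
    rw [ht] at h2
    simp at h2
    refine ⟨?_, ht⟩
    rcases h2 with h2 | h2
    · exact h2
    · linarith
  have hdet : latticeDet ![L • v, (k : ℝ) • v + w] = L * latticeDet ![v, w] := by
    rw [latticeDet_two, latticeDet_two]
    have : (0:ℝ) ≤ L := by linarith
    have e : L * |(![v, w] 0) 0 * (![v, w] 1) 1 - (![v, w] 1) 0 * (![v, w] 0) 1|
        = |L * ((![v, w] 0) 0 * (![v, w] 1) 1 - (![v, w] 1) 0 * (![v, w] 0) 1)| := by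
      rw [abs_mul, abs_of_nonneg this]
    rw [e]
    congr 1
    simp
    ring
  rw [← vol_interior hT, ← hdet]
  apply mink1 _ hli _ hT.interior
  · intro x hx
    exact neg_mem_interior hsym hx
  · intro m j hmj
    simp only [Matrix.cons_val_zero, Matrix.cons_val_one] at hmj
    have posj : ∀ m j : ℤ, 0 < j → (m : ℝ) • L • v + (j : ℝ) • ((k : ℝ) • v + w) ∉ T := by
      intro m j hj hin
      have hjr : (1 : ℝ) ≤ j := by exact_mod_cast hj
      have hj0 : (j : ℝ) ≠ 0 := by positivity
      have h1 := hscale _ hin (1 / j) (by positivity) (by rw [div_le_one (by linarith)]; exact hjr)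
      have h2 : ((m : ℝ) * L / j + k) • v + w ∈ T := by
        convert h1 using 1
        rw [smul_add, smul_smul, smul_smul, smul_smul]
        have : (1 / (j:ℝ) * j) = 1 := by field_simp
        rw [this]
        module
      obtain ⟨a1, a2⟩ := hk _ h2
      have m0 : 0 < (m : ℝ) * L / j := by linarith
      have m1 : (m : ℝ) * L / j < 1 := by linarith
      have jp : (0 : ℝ) < j := by linarith
      rw [div_lt_one jp] at m1
      have mL : 0 < (m : ℝ) * L := by
        have := mul_pos m0 jp
        rwa [div_mul_cancel₀ _ hj0] at this
      have mp : (0 : ℝ) < m := pos_of_mul_pos_left mL (by linarith)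
      have mj : (m : ℝ) < j := by nlinarith
      have mj' : m < j := by exact_mod_cast mj
      have mp' : 0 < m := by exact_mod_cast mp
      have mj1 : (m : ℝ) ≤ j - 1 := by
        have : m ≤ j - 1 := by omega
        exact_mod_cast this
      have mp1 : (1 : ℝ) ≤ m := by exact_mod_cast mp'
      have j1 : (0 : ℝ) < j - 1 := by linarith
      have h3 := hscale _ (hsym _ hLv) (m / (j - 1)) (by positivity) (by rw [div_le_one j1]; exact mj1)
      have h4 := hT hin h3 (a := 1 / (j:ℝ)) (b := (j - 1) / j) (by positivity) (by positivity)
        (by field_simp; ring)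
      apply hno k 1 one_ne_zero
      convert h4 using 1
      have e1 : (1 / (j:ℝ) * j) = 1 := by field_simp
      have e2 : ((j:ℝ) - 1) / j * (m / (j - 1)) = m / j := by field_simp
      rw [smul_add, smul_smul, smul_smul, smul_smul, smul_smul, e1, e2]
      push_cast
      module
    have hj : j = 0 := by
      rcases lt_trichotomy j 0 with h | h | h
      · exfalso
        apply posj (-m) (-j) (by omega)
        have := hsym _ (interior_subset hmj)
        convert this using 1
        push_cast
        module
      · exact h
      · exact absurd (interior_subset hmj) (posj m j h)
    refine ⟨?_, hj⟩
    subst hj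
    simp only [Int.cast_zero, zero_smul, add_zero] at hmj
    have key : ∀ m : ℤ, 0 < m → (m : ℝ) • L • v ∉ interior T := by
      intro m hm hin
      have cont : Continuous (fun r : ℝ => r • v) := by fun_prop
      have : {r : ℝ | r • v ∈ interior T} ∈ nhds ((m : ℝ) * L) := by
        apply (isOpen_interior.preimage cont).mem_nhds
        simpa [smul_smul] using hin
      obtain ⟨ε, hε, hsub⟩ := Metric.mem_nhds_iff.1 this
      have h2 : (m : ℝ) * L + ε / 2 ∈ {r : ℝ | r • v ∈ interior T} := by
        apply hsub
        simp [abs_of_pos hε]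
        exact hε
      have h3 := hmax _ (interior_subset h2)
      have : (1 : ℝ) ≤ m := by exact_mod_cast hm
      nlinarith
    rcases lt_trichotomy m 0 with h | h | h
    · exfalso
      apply key (-m) (by omega)
      have := neg_mem_interior hsym hmj
      convert this using 1
      push_cast
      module
    · exact h
    · exact absurd hmj (key m h)

lemma mink2 (S : Set (Euc 2)) (hS : Convex ℝ S) (hcpt : IsCompact S) (hsym : ∀ x ∈ S, -x ∈ S)
    (h0 : (0 : Euc 2) ∈ S) (b : Fin 2 → Euc 2) (hb : LinearIndependent ℝ b) (t₁ t₂ : ℝ)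
    (ht₁ : 0 < t₁) (ht : t₁ ≤ t₂)
    (h1 : ∀ w ∈ latticeOf b, w ≠ 0 → w ∉ t₁ • S)
    (h2 : ∀ v : Fin 2 → Euc 2, LinearIndependent ℝ v → (∀ i, v i ∈ latticeOf b ∧ v i ∈ t₂ • S) →
      False) :
    t₁ * t₂ * volume.real S ≤ 4 * latticeDet b := by
  have ht₂ : 0 < t₂ := ht₁.trans_le ht
  have hvol : volume.real (t₂ • S) = t₂ ^ 2 * volume.real S := by
    rw [measureReal_def, Measure.addHaar_smul]
    simp [measureReal_def]
    left; positivity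
  set T := t₂ • S with hTdef
  have hT : Convex ℝ T := hS.smul t₂
  have hTc : IsCompact T := hcpt.smul t₂
  have hTs : ∀ x ∈ T, -x ∈ T := by
    rintro _ ⟨x, hx, rfl⟩
    exact ⟨-x, hsym x hx, by simp⟩
  have hT0 : (0 : Euc 2) ∈ T := ⟨0, h0, by simp⟩
  have dnn : ∀ c : Fin 2 → Euc 2, 0 ≤ latticeDet c := fun c => abs_nonneg _
  have toR : ∀ r : ℝ, 0 ≤ r → volume T ≤ ENNReal.ofReal r * 4 → t₂ ^ 2 * volume.real S ≤ r * 4 := by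
    intro r hr h
    rw [← hvol, measureReal_def]
    have := ENNReal.toReal_mono (by finiteness) h
    simpa [hr] using this
  have hpi : ∀ x y : ℝ, x • b 0 + y • b 1 = 0 → x = 0 ∧ y = 0 := by
    have e : b = ![b 0, b 1] := by ext i j; fin_cases i <;> rfl
    rw [e] at hb
    exact LinearIndependent.pair_iff.1 hb
  have hmem : ∀ x y : ℤ, (x : ℝ) • b 0 + (y : ℝ) • b 1 ∈ latticeOf b := fun x y =>
    ⟨![x, y], by simp⟩
  by_cases hA : ∀ m j : ℤ, (m : ℝ) • b 0 + (j : ℝ) • b 1 ∈ T → m = 0 ∧ j = 0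
  · have := toR _ (dnn b) (mink1 b hb T hT hTs hA)
    have vn : 0 ≤ volume.real S := measureReal_nonneg
    have : t₁ * t₂ * volume.real S ≤ t₂ ^ 2 * volume.real S := by
      apply mul_le_mul_of_nonneg_right _ vn
      nlinarith
    linarith
  · push Not at hA
    obtain ⟨m, j, hin, hne⟩ := hA
    have hg : 0 < Int.gcd m j := by
      rw [Int.gcd_pos_iff]
      by_cases h : m = 0
      · exact Or.inr (hne h)
      · exact Or.inl h
    obtain ⟨p, q, hpq, hm, hj⟩ := Int.exists_gcd_one hg
    set g := Int.gcd m j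
    have hgr : (1 : ℝ) ≤ (g : ℝ) := by exact_mod_cast hg
    obtain ⟨r, s, hrs⟩ : ∃ r s : ℤ, p * s - q * r = 1 := by
      have := Int.gcd_eq_gcd_ab p q
      rw [hpq] at this
      refine ⟨-Int.gcdB p q, Int.gcdA p q, ?_⟩
      push_cast at this
      linarith
    have hrsR : (p : ℝ) * s - q * r = 1 := by exact_mod_cast hrs
    set v : Euc 2 := (p : ℝ) • b 0 + (q : ℝ) • b 1 with hv
    set w : Euc 2 := (r : ℝ) • b 0 + (s : ℝ) • b 1 with hw
    have hvT : v ∈ T := by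
      have := hT hin hT0 (a := 1 / (g:ℝ)) (b := 1 - 1 / (g:ℝ)) (by positivity)
        (by rw [sub_nonneg, div_le_one (by linarith)]; exact hgr) (by ring)
      convert this using 1
      rw [hm, hj]
      push_cast
      have e : (1 / (g:ℝ)) * g = 1 := by field_simp
      rw [smul_zero, add_zero, smul_add, smul_smul, smul_smul]
      rw [show 1 / (g:ℝ) * ((p:ℝ) * g) = p by field_simp, show 1 / (g:ℝ) * ((q:ℝ) * g) = q by field_simp]
    have hvw : ∀ x y : ℝ, x • v + y • w = 0 → x = 0 ∧ y = 0 := by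
      intro x y hxy
      obtain ⟨e1, e2⟩ := hpi (x * p + y * r) (x * q + y * s) (by rw [← hxy, hv, hw]; module)
      constructor
      · linear_combination s * e1 - r * e2 - x * hrsR
      · linear_combination p * e2 - q * e1 - y * hrsR
    have hli : LinearIndependent ℝ ![v, w] := LinearIndependent.pair_iff.2 hvw
    have hdet : latticeDet ![v, w] = latticeDet b := by
      rw [latticeDet_two, latticeDet_two]
      congr 1
      simp [hv, hw]
      linear_combination (b 0 0 * b 1 1 - b 1 0 * b 0 1) * hrsR
    have hv0 : v ≠ 0 := by
      intro h
      have := (hvw 1 0 (by simp [h])).1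
      norm_num at this
    -- maximal multiple
    have hcl : IsCompact {x : ℝ | x • v ∈ T} := by
      have := (isClosedEmbedding_smul_left (𝕜 := ℝ) hv0).isCompact_preimage hTc
      exact this
    obtain ⟨L, hLT, hLmax⟩ := hcl.exists_isGreatest ⟨1, by simpa using hvT⟩
    have hL1 : 1 ≤ L := hLmax (by simpa using hvT)
    have hmain := mink2a T hT hTs v w hli L hL1 hLT (fun x hx => hLmax hx) (by
      intro a j hj hin
      apply h2 ![v, (a : ℝ) • v + (j : ℝ) • w]
      · rw [LinearIndependent.pair_iff]
        intro x y hxy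
        obtain ⟨e1, e2⟩ := hvw (x + y * a) (y * j) (by rw [← hxy]; module)
        have hj' : (j : ℝ) ≠ 0 := by exact_mod_cast hj
        have y0 : y = 0 := by
          rcases mul_eq_zero.1 e2 with h | h
          · exact h
          · exact absurd h hj'
        rw [y0] at e1
        exact ⟨by simpa using e1, y0⟩
      · intro i
        fin_cases i
        · exact ⟨hmem p q, hvT⟩
        · refine ⟨?_, hin⟩
          have := hmem (a * p + j * r) (a * q + j * s)
          convert this using 1
          simp only [hv, hw]
          push_cast
          simp
          module)
    have hLd := toR _ (mul_nonneg (by linarith) (dnn _)) hmain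
    rw [hdet] at hLd
    have hlt : t₁ * L ≤ t₂ := by
      by_contra hgt
      push Not at hgt
      apply h1 v (hmem p q) hv0
      obtain ⟨y, hy, hyL⟩ := hLT
      simp only at hyL
      have tp : 0 < t₁ * L := by positivity
      refine ⟨(t₂ / (t₁ * L)) • y, ?_, ?_⟩
      · have := hS hy h0 (a := t₂ / (t₁ * L)) (b := 1 - t₂ / (t₁ * L)) (by positivity)
          (by rw [sub_nonneg, div_le_one tp]; exact hgt.le) (by ring)
        simpa using this
      · simp only
        have e : v = (1 / L) • (L • v) := by
          rw [smul_smul]; field_simp; simp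
        rw [e, ← hyL, smul_smul, smul_smul]
        congr 1
        field_simp
    have d0 := dnn b
    have e1 : t₁ * (t₂ ^ 2 * volume.real S) ≤ t₁ * (L * latticeDet b * 4) := by gcongr
    have e2 : t₁ * L * (latticeDet b * 4) ≤ t₂ * (latticeDet b * 4) := by gcongr
    have : t₂ * (t₁ * t₂ * volume.real S) ≤ t₂ * (4 * latticeDet b) := by nlinarith
    exact le_of_mul_le_mul_left this ht₂

lemma stdSimplex_two (x : Euc 2) :
    x ∈ stdSimplexSet 2 ↔ 0 ≤ x 0 ∧ 0 ≤ x 1 ∧ x 0 + x 1 ≤ 1 := by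
  constructor
  · intro hx
    have hconv : Convex ℝ {x : Euc 2 | 0 ≤ x 0 ∧ 0 ≤ x 1 ∧ x 0 + x 1 ≤ 1} := by
      intro a ha b hb s t hs ht hst
      obtain ⟨a1, a2, a3⟩ := ha
      obtain ⟨b1, b2, b3⟩ := hb
      refine ⟨?_, ?_, ?_⟩
      · simp; positivity
      · simp; positivity
      · simp
        nlinarith
    have := convexHull_min (s := insert 0 (Set.range fun i : Fin 2 => EuclideanSpace.single i (1 : ℝ)))
      (by
        intro y hy
        rcases hy with rfl | ⟨i, rfl⟩
        · simp
        · fin_cases i <;> simp) hconv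
    exact this hx
  · rintro ⟨h1, h2, h3⟩
    have hc := convex_convexHull ℝ (insert (0 : Euc 2) (Set.range fun i : Fin 2 => EuclideanSpace.single i (1 : ℝ)))
    have := hc.sum_mem (t := Finset.univ) (w := ![1 - x 0 - x 1, x 0, x 1])
      (z := ![0, EuclideanSpace.single 0 1, EuclideanSpace.single 1 1])
      (by intro i _; fin_cases i <;> simp <;> linarith)
      (by simp [Fin.sum_univ_three]; ring)
      (by
        intro i _
        apply subset_convexHull
        fin_cases i
        · exact Or.inl rfl
        · exact Or.inr ⟨0, rfl⟩
        · exact Or.inr ⟨1, rfl⟩)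
    have e : x = ∑ i, (![1 - x 0 - x 1, x 0, x 1] : Fin 3 → ℝ) i •
        (![0, EuclideanSpace.single 0 1, EuclideanSpace.single 1 1] : Fin 3 → Euc 2) i := by
      ext i
      fin_cases i <;> simp [Fin.sum_univ_three]
    rw [← e] at this
    exact this

lemma mem_Tn_two (x : Euc 2) : x ∈ Tn 2 ↔ -1 ≤ x 0 ∧ -1 ≤ x 1 ∧ x 0 + x 1 ≤ 1 := by
  unfold Tn
  constructor
  · rintro ⟨y, hy, rfl⟩
    rw [stdSimplex_two] at hy
    obtain ⟨h1, h2, h3⟩ := hy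
    simp [allOnes]
    refine ⟨?_, ?_, ?_⟩ <;> linarith
  · rintro ⟨h1, h2, h3⟩
    refine ⟨(1/3 : ℝ) • (x + allOnes 2), ?_, ?_⟩
    · rw [stdSimplex_two]
      simp [allOnes]
      refine ⟨?_, ?_, ?_⟩ <;> linarith
    · simp only [smul_smul]
      norm_num

def Rg : Set (ℝ × ℝ) := {p | -1 ≤ p.1 ∧ -1 ≤ p.2 ∧ p.1 + p.2 ≤ 1}

lemma Rg_compact : IsCompact Rg := by
  apply (isCompact_Icc (a := ((-1 : ℝ), (-1 : ℝ))) (b := ((2 : ℝ), (2 : ℝ)))).of_isClosed_subset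
  · apply IsClosed.inter (isClosed_le continuous_const continuous_fst)
    apply IsClosed.inter (isClosed_le continuous_const continuous_snd)
    exact isClosed_le (continuous_fst.add continuous_snd) continuous_const
  · rintro ⟨x, y⟩ ⟨h1, h2, h3⟩
    simp only at h1 h2 h3
    constructor <;> constructor <;> simp <;> linarith

lemma Rg_vol : volume.real Rg = 9 / 2 := by
  have h := (fubini Rg_compact (continuous_const (y := (1:ℝ)))).2
  simp only [one_mul] at h
  rw [setIntegral_const, smul_eq_mul, mul_one] at h
  rw [h]
  have : sl Rg = (Icc (-1 : ℝ) 2).indicator (fun y => 2 - y) := by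
    ext y
    unfold sl
    by_cases hy : y ∈ Icc (-1 : ℝ) 2
    · rw [indicator_of_mem hy]
      have : {x : ℝ | (x, y) ∈ Rg} = Icc (-1) (1 - y) := by
        ext x
        simp only [Rg, mem_ofPred_eq, mem_Icc]
        constructor
        · rintro ⟨h1, h2, h3⟩; exact ⟨h1, by linarith⟩
        · rintro ⟨h1, h2⟩; exact ⟨h1, hy.1, by linarith⟩
      rw [this, Real.volume_real_Icc_of_le (by linarith [hy.2])]
      ring
    · rw [indicator_of_notMem hy]
      have : {x : ℝ | (x, y) ∈ Rg} = ∅ := by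
        ext x
        simp only [Rg, mem_ofPred_eq, mem_empty_iff_false, iff_false]
        rintro ⟨h1, h2, h3⟩
        exact hy ⟨h2, by linarith⟩
      rw [this]; simp
  rw [this, integral_indicator measurableSet_Icc, integral_Icc_eq_integral_Ioc,
      ← intervalIntegral.integral_of_le (by norm_num)]
  rw [intervalIntegral.integral_sub (by simp) (by simp)]
  simp
  norm_num

lemma Tn_vol : (volume (Tn 2)).toReal = 9 / 2 := by
  have hm : MeasurePreserving (fun x : Euc 2 => (x 0, x 1)) volume volume :=
    (volume_preserving_finTwoArrow ℝ).comp (PiLp.volume_preserving_ofLp (Fin 2))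
  have e : Tn 2 = (fun x : Euc 2 => (x 0, x 1)) ⁻¹' Rg := by
    ext x; rw [mem_Tn_two]; rfl
  rw [e, hm.measure_preimage Rg_compact.measurableSet.nullMeasurableSet]
  exact Rg_vol

lemma Tn_lower {x : Euc 2} (hx : x ∈ stdLattice 2) (h0 : x ≠ 0) {t : ℝ} (ht : 0 < t)
    (hxt : x ∈ t • Tn 2) : 1 ≤ t := by
  obtain ⟨y, hy, rfl⟩ := hxt
  rw [mem_Tn_two] at hy
  obtain ⟨h1, h2, h3⟩ := hy
  obtain ⟨m, hm⟩ := hx 0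
  obtain ⟨k, hk⟩ := hx 1
  simp at hm hk
  by_contra hlt
  push Not at hlt
  have m0 : (-1 : ℝ) < m := by rw [← hm]; nlinarith
  have k0 : (-1 : ℝ) < k := by rw [← hk]; nlinarith
  have s0 : (m : ℝ) + k < 1 := by rw [← hm, ← hk]; nlinarith
  have m0' : -1 < m := by exact_mod_cast m0
  have k0' : -1 < k := by exact_mod_cast k0
  have s0' : m + k < 1 := by exact_mod_cast s0
  have em : m = 0 := by omega
  have ek : k = 0 := by omega
  apply h0
  ext i
  fin_cases i
  · simp [hm, em]
  · simp [hk, ek]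

lemma Tn_min (i : ℕ) (hi : i = 1 ∨ i = 2) : succMin (Tn 2) (stdLattice 2) i = 1 := by
  unfold succMin
  apply IsLeast.csInf_eq
  constructor
  · refine ⟨one_pos, ?_⟩
    have mem : ∀ j : Fin 2, (EuclideanSpace.single j (1:ℝ)) ∈ stdLattice 2 ∧
        (EuclideanSpace.single j (1:ℝ)) ∈ (1:ℝ) • Tn 2 := by
      intro j
      rw [one_smul, mem_Tn_two]
      constructor
      · intro k
        fin_cases j <;> fin_cases k
        · exact ⟨1, by simp⟩
        · exact ⟨0, by simp⟩
        · exact ⟨0, by simp⟩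
        · exact ⟨1, by simp⟩
      · fin_cases j <;> simp
    have li : LinearIndependent ℝ (fun j : Fin 2 => (EuclideanSpace.single j (1:ℝ) : Euc 2)) := by
      have := (EuclideanSpace.basisFun (Fin 2) ℝ).toBasis.linearIndependent
      have e : (fun j : Fin 2 => (EuclideanSpace.single j (1:ℝ) : Euc 2)) =
          ⇑(EuclideanSpace.basisFun (Fin 2) ℝ) := by
        funext j; simp
      rw [e]
      simpa using this
    have hi2 : i ≤ 2 := by omega
    refine ⟨fun j => EuclideanSpace.single (Fin.castLE hi2 j) 1, ?_, fun j => mem _⟩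
    exact li.comp _ (Fin.castLE_injective hi2)
  · rintro t ⟨ht, v, hv, hmem⟩
    have ip : 0 < i := by omega
    exact Tn_lower (hmem ⟨0, ip⟩).1 (hv.ne_zero _) ht (hmem ⟨0, ip⟩).2


lemma zero_int {K : Set (Euc 2)} (hK : IsConvexBody K) (hcen : CentroidAtOrigin K) :
    (0 : Euc 2) ∈ interior K := by
  obtain ⟨hcv, hcp, hne⟩ := hK
  by_contra h0
  obtain ⟨f, hf⟩ := geometric_hahn_banach_open_point hcv.interior isOpen_interior h0
  rw [map_zero] at hf
  have hfin : volume K ≠ ∞ := hcp.measure_lt_top.ne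
  have hint : IntegrableOn (fun x : Euc 2 => x) K :=
    continuous_id.continuousOn.integrableOn_compact hcp
  have h1 : ∫ x in K, f x = 0 := by
    rw [ContinuousLinearMap.integral_comp_comm f hint, hcen, map_zero]
  have hae : (interior K : Set (Euc 2)) =ᵐ[volume] K :=
    interior_ae_eq_of_null_frontier (hcv.addHaar_frontier volume)
  have h2 : ∫ x in interior K, f x = 0 := by
    rw [setIntegral_congr_set hae, h1]
  have hi2 : IntegrableOn (fun x : Euc 2 => - f x) (interior K) :=
    (IntegrableOn.mono_set (f.integrable_comp hint) interior_subset).neg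
  have h3 : 0 < ∫ x in interior K, - f x := by
    rw [setIntegral_pos_iff_support_of_nonneg_ae]
    · apply lt_of_lt_of_le (isOpen_interior.measure_pos volume hne)
      apply measure_mono
      intro x hx
      refine ⟨?_, hx⟩
      simp only [Function.mem_support]
      have := hf x hx
      intro e
      linarith
    · rw [EventuallyLE, ae_restrict_iff' isOpen_interior.measurableSet]
      exact ae_of_all _ fun x hx => by
        have := hf x hx
        simp only [Pi.zero_apply]
        linarith
    · exact hi2
  rw [integral_neg, h2] at h3
  simp at h3

lemma chord {K : Set (Euc 2)} (hcv : Convex ℝ K) (hcp : IsCompact K) (h0 : (0 : Euc 2) ∈ interior K) :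
    ∃ u : Euc 2, u ≠ 0 ∧ u ∈ K ∧ -u ∈ K ∧ u ∉ interior K ∧ -u ∉ interior K := by
  have hn : K ∈ nhds (0 : Euc 2) := mem_interior_iff_mem_nhds.mp h0
  have habs : Absorbent ℝ K := absorbent_nhds_zero hn
  have hgc : Continuous (gauge K) := continuous_gauge hcv hn
  let γ : ℝ → Euc 2 := fun θ => Real.cos θ • EuclideanSpace.single 0 1 + Real.sin θ • EuclideanSpace.single 1 1
  have γc : Continuous γ := by fun_prop
  let g : ℝ → ℝ := fun θ => gauge K (γ θ) - gauge K (- γ θ)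
  have gc : Continuous g := (hgc.comp γc).sub (hgc.comp γc.neg)
  have gpi : g Real.pi = - g 0 := by
    simp [g, γ]
  have hz : ∃ θ, g θ = 0 := by
    rcases le_total (g 0) 0 with h | h
    · exact mem_range_of_exists_le_of_exists_ge gc ⟨0, h⟩ ⟨Real.pi, by rw [gpi]; linarith⟩
    · exact mem_range_of_exists_le_of_exists_ge gc ⟨Real.pi, by rw [gpi]; linarith⟩ ⟨0, h⟩
  obtain ⟨θ, hθ⟩ := hz
  have γ0 : γ θ ≠ 0 := by
    intro h
    have a0 := congrArg (fun x : Euc 2 => x 0) h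
    have a1 := congrArg (fun x : Euc 2 => x 1) h
    simp [γ] at a0 a1
    have := Real.sin_sq_add_cos_sq θ
    rw [a0, a1] at this
    norm_num at this
  have hpos : 0 < gauge K (γ θ) := (gauge_pos habs (NormedSpace.isVonNBounded_iff ℝ |>.mpr hcp.isBounded)).mpr γ0
  set r := gauge K (γ θ) with hr
  have heq : gauge K (-γ θ) = r := by
    have : gauge K (γ θ) - gauge K (- γ θ) = 0 := hθ
    linarith
  have gu : gauge K (r⁻¹ • γ θ) = 1 := by
    rw [gauge_smul_of_nonneg (by positivity), smul_eq_mul, ← hr]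
    field_simp
  have gu' : gauge K (-(r⁻¹ • γ θ)) = 1 := by
    rw [← smul_neg, gauge_smul_of_nonneg (by positivity), smul_eq_mul, heq]
    field_simp
  have hcl : closure K = K := hcp.isClosed.closure_eq
  refine ⟨r⁻¹ • γ θ, smul_ne_zero (by positivity) γ0, ?_, ?_, ?_, ?_⟩
  · rw [← hcl, ← gauge_le_one_iff_mem_closure hcv hn, gu]
  · rw [← hcl, ← gauge_le_one_iff_mem_closure hcv hn, gu']
  · rw [← gauge_lt_one_iff_mem_interior hcv hn, gu]; simp
  · rw [← gauge_lt_one_iff_mem_interior hcv hn, gu']; simp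

lemma support {K : Set (Euc 2)} (hcv : Convex ℝ K) (hcp : IsCompact K) (h0 : (0 : Euc 2) ∈ interior K)
    {u : Euc 2} (hu : u ∉ interior K) :
    ∃ f : Euc 2 →L[ℝ] ℝ, f u = 1 ∧ ∀ x ∈ K, f x ≤ 1 := by
  obtain ⟨f, hf⟩ := geometric_hahn_banach_open_point hcv.interior isOpen_interior hu
  have hp : 0 < f u := by simpa using hf 0 h0
  refine ⟨(f u)⁻¹ • f, ?_, ?_⟩
  · simp [hp.ne']
  · intro x hx
    have hx' : x ∈ closure (interior K) := by
      rw [hcv.closure_interior_eq_closure_of_nonempty_interior ⟨0, h0⟩]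
      exact subset_closure hx
    have : f x ≤ f u := by
      have hsub : interior K ⊆ {y | f y ≤ f u} := fun y hy => (hf y hy).le
      exact closure_minimal hsub (isClosed_le f.continuous continuous_const) hx'
    simp only [smul_apply, smul_eq_mul]
    rw [inv_mul_le_iff₀ hp]
    linarith

/-- linear coordinates -/
lemma coords {u w : Euc 2} (h : LinearIndependent ℝ ![u, w]) :
    ∃ φ : (ℝ × ℝ) ≃L[ℝ] Euc 2, ∀ p, φ p = p.1 • u + p.2 • w := by
  let B := basisOfLinearIndependentOfCardEqFinrank h (by simp)
  refine ⟨((LinearEquiv.finTwoArrow ℝ ℝ).symm.trans B.equivFun.symm).toContinuousLinearEquiv, ?_⟩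
  intro p
  simp [B, Module.Basis.equivFun_symm_apply, LinearEquiv.finTwoArrow]

lemma setup {K : Set (Euc 2)} (hK : IsConvexBody K) (hcen : CentroidAtOrigin K) :
    ∃ (φ : (ℝ × ℝ) ≃L[ℝ] Euc 2) (a c : ℝ), 0 ≤ a + c ∧ φ (1, 0) ∈ K ∧ φ (-1, 0) ∈ K ∧
      ∀ p, φ p ∈ K → p.1 + a * p.2 ≤ 1 ∧ - p.1 + c * p.2 ≤ 1 := by
  have h0 := zero_int hK hcen
  obtain ⟨hcv, hcp, hne⟩ := hK
  obtain ⟨u, hu0, huK, hnuK, hui, hnui⟩ := chord hcv hcp h0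
  obtain ⟨f, hfu, hf⟩ := support hcv hcp h0 hui
  obtain ⟨m, hmu, hm⟩ := support hcv hcp h0 hnui
  have hmu' : m u = -1 := by
    rw [map_neg] at hmu; linarith
  have hw : ∃ w : Euc 2, LinearIndependent ℝ ![u, w] ∧ 0 ≤ f w + m w := by
    let w : Euc 2 := !₂[- u 1, u 0]
    have hli : ∀ e : ℝ, e ≠ 0 → LinearIndependent ℝ ![u, e • w] := by
      intro e he
      rw [LinearIndependent.pair_iff]
      intro s t hst
      have a0 := congrArg (fun x : Euc 2 => x 0) hst
      have a1 := congrArg (fun x : Euc 2 => x 1) hst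
      simp [w] at a0 a1
      have hq : 0 < u 0 ^ 2 + u 1 ^ 2 := by
        by_contra hc
        apply hu0
        have e0 : u 0 = 0 := by nlinarith [sq_nonneg (u 0), sq_nonneg (u 1)]
        have e1 : u 1 = 0 := by nlinarith [sq_nonneg (u 0), sq_nonneg (u 1)]
        ext i; fin_cases i <;> simp [e0, e1]
      have s0 : s * (u 0 ^ 2 + u 1 ^ 2) = 0 := by linear_combination u 0 * a0 + u 1 * a1
      have t0 : (t * e) * (u 0 ^ 2 + u 1 ^ 2) = 0 := by linear_combination u 0 * a1 - u 1 * a0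
      constructor
      · rcases mul_eq_zero.mp s0 with h | h
        · exact h
        · linarith
      · rcases mul_eq_zero.mp t0 with h | h
        · exact (mul_eq_zero.mp h).resolve_right he
        · linarith
    rcases le_total 0 (f w + m w) with h | h
    · exact ⟨(1:ℝ) • w, hli 1 one_ne_zero, by simpa using h⟩
    · exact ⟨(-1:ℝ) • w, hli (-1) (by norm_num), by simp; linarith⟩
  obtain ⟨w, hli, hw⟩ := hw
  obtain ⟨φ, hφ⟩ := coords hli
  refine ⟨φ, f w, m w, hw, ?_, ?_, ?_⟩
  · rw [hφ]; simpa using huK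
  · rw [hφ]; simpa using hnuK
  · intro p hp
    have h1 := hf _ hp
    have h2 := hm _ hp
    rw [hφ] at h1 h2
    simp [hfu, hmu'] at h1 h2
    constructor <;> linarith

lemma S_convex {K : Set (ℝ × ℝ)} (hK : Convex ℝ K) {a c : ℝ} (hac : 0 ≤ a + c)
    (h1 : ((1 : ℝ), (0 : ℝ)) ∈ K) (h2 : ((-1 : ℝ), (0 : ℝ)) ∈ K)
    (hs : ∀ p ∈ K, p.1 + a * p.2 ≤ 1 ∧ - p.1 + c * p.2 ≤ 1) :
    Convex ℝ ((K ∩ {p | 0 ≤ p.2}) ∪ -(K ∩ {p | 0 ≤ p.2})) := by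
  set C : Set (ℝ × ℝ) := K ∩ {p | 0 ≤ p.2} with hC
  have hCc : Convex ℝ C := hK.inter (convex_halfSpace_ge (f := fun p : ℝ × ℝ => p.2) (IsLinearMap.mk (fun _ _ => rfl) (fun _ _ => rfl)) 0)
  have hnC : Convex ℝ (-C) := hCc.neg
  -- the strip
  have strip : ∀ p ∈ C, |p.1 + a * p.2| ≤ 1 := by
    rintro p ⟨hp, hp2⟩
    have hp2' : 0 ≤ p.2 := hp2
    obtain ⟨e1, e2⟩ := hs p hp
    rw [abs_le]
    constructor
    · nlinarith [mul_nonneg hac hp2']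
    · exact e1
  have axis : ∀ x : ℝ, |x| ≤ 1 → (x, (0 : ℝ)) ∈ C := by
    intro x hx
    rw [abs_le] at hx
    refine ⟨?_, le_refl (0 : ℝ)⟩
    have := hK h1 h2 (a := (1 + x) / 2) (b := (1 - x) / 2) (by linarith) (by linarith) (by ring)
    have e : (x, (0 : ℝ)) = ((1 + x) / 2) • ((1 : ℝ), (0 : ℝ)) + ((1 - x) / 2) • ((-1 : ℝ), (0 : ℝ)) := by
      ext <;> simp; ring
    rw [e]; exact this
  have naxis : ∀ x : ℝ, |x| ≤ 1 → (x, (0 : ℝ)) ∈ -C := by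
    intro x hx
    have := axis (-x) (by rwa [abs_neg])
    simpa using this
  -- mixed segments
  have mixed : ∀ p ∈ C, ∀ q ∈ -C, segment ℝ p q ⊆ C ∪ -C := by
    intro p hp q hq
    have hp2 : 0 ≤ p.2 := hp.2
    have hq2 : q.2 ≤ 0 := by
      have : 0 ≤ (-q).2 := hq.2
      simpa using this
    have sp := strip p hp
    have sq := strip (-q) hq
    have sq' : |q.1 + a * q.2| ≤ 1 := by
      rw [← abs_neg]; convert sq using 2; simp; ring
    rw [abs_le] at sp sq'
    obtain ⟨z, hz, hzC, hzN⟩ : ∃ z ∈ segment ℝ p q, z ∈ C ∧ z ∈ -C := by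
      rcases eq_or_lt_of_le (show 0 ≤ p.2 - q.2 by linarith) with h | h
      · have : p.2 = 0 := by linarith
        refine ⟨p, left_mem_segment ℝ p q, hp, ?_⟩
        have e : p = (p.1, 0) := by ext <;> simp [this]
        rw [e]
        apply naxis
        rw [abs_le]
        rw [this] at sp
        constructor <;> linarith [sp.1, sp.2]
      · have hz : (((- q.2) * p.1 + p.2 * q.1) / (p.2 - q.2), (0 : ℝ)) ∈ segment ℝ p q := by
          refine ⟨(-q.2) / (p.2 - q.2), p.2 / (p.2 - q.2), by apply div_nonneg <;> linarith, by positivity, by field_simp; ring, ?_⟩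
          ext
          · simp; field_simp
          · simp; field_simp; ring
        have hb : |((- q.2) * p.1 + p.2 * q.1) / (p.2 - q.2)| ≤ 1 := by
          rw [abs_le, le_div_iff₀ h, div_le_iff₀ h]
          constructor <;> nlinarith [mul_nonneg hp2 (sub_nonneg.mpr sq'.1), mul_nonneg hp2 (sub_nonneg.mpr sq'.2), mul_nonneg (neg_nonneg.mpr hq2) (sub_nonneg.mpr sp.1), mul_nonneg (neg_nonneg.mpr hq2) (sub_nonneg.mpr sp.2)]
        exact ⟨_, hz, axis _ hb, naxis _ hb⟩
    intro x hx
    have : x ∈ segment ℝ p z ∪ segment ℝ z q := by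
      have hw : Wbtw ℝ p z q := mem_segment_iff_wbtw.mp hz
      have hx' : Wbtw ℝ p x q := mem_segment_iff_wbtw.mp hx
      obtain ⟨t, ⟨t0, t1⟩, rfl⟩ := hw
      obtain ⟨s, ⟨s0, s1⟩, rfl⟩ := hx'
      rcases le_total s t with hst | hst
      · left
        rw [mem_segment_iff_wbtw]
        have hr : Wbtw ℝ (0 : ℝ) s t := mem_segment_iff_wbtw.mp
          (by rw [segment_eq_Icc (s0.trans hst)]; exact ⟨s0, hst⟩)
        simpa using hr.map (AffineMap.lineMap p q)
      · right
        rw [mem_segment_iff_wbtw]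
        have hr : Wbtw ℝ t s (1 : ℝ) := mem_segment_iff_wbtw.mp
          (by rw [segment_eq_Icc (hst.trans s1)]; exact ⟨hst, s1⟩)
        simpa using hr.map (AffineMap.lineMap p q)
    rcases this with h | h
    · exact Or.inl (hCc.segment_subset hp hzC h)
    · exact Or.inr (hnC.segment_subset hzN hq h)
  rw [convex_iff_segment_subset]
  rintro p (hp | hp) q (hq | hq)
  · exact (hCc.segment_subset hp hq).trans subset_union_left
  · exact mixed p hp q hq
  · rw [segment_symm]; exact mixed q hq p hp
  · exact (hnC.segment_subset hp hq).trans subset_union_right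

lemma S_vol {K : Set (ℝ × ℝ)} (hc : IsCompact K) :
    2 * volume.real (K ∩ {p | 0 ≤ p.2}) =
      volume.real ((K ∩ {p | 0 ≤ p.2}) ∪ -(K ∩ {p | 0 ≤ p.2})) := by
  have hCc : IsCompact (K ∩ {p : ℝ × ℝ | 0 ≤ p.2}) :=
    hc.inter_right (isClosed_le continuous_const continuous_snd)
  set C : Set (ℝ × ℝ) := K ∩ {p | 0 ≤ p.2} with hC
  have hnull : volume {p : ℝ × ℝ | p.2 = 0} = 0 := by
    have e : {p : ℝ × ℝ | p.2 = 0} = univ ×ˢ {0} := by ext; simp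
    rw [e, Measure.volume_eq_prod, Measure.prod_prod]
    simp
  have hneg : volume.real (-C) = volume.real C := by
    simp [Measure.real, Measure.measure_neg]
  have hd : AEDisjoint volume C (-C) := by
    apply measure_mono_null _ hnull
    rintro p ⟨h1, h2⟩
    have a1 : 0 ≤ p.2 := h1.2
    have a2 : 0 ≤ (-p).2 := h2.2
    simp at a2
    show p.2 = 0
    linarith
  have := measureReal_union₀ (μ := volume) (s := C) (t := -C) hCc.neg.measurableSet.nullMeasurableSet hd
    hCc.measure_lt_top.ne hCc.neg.measure_lt_top.ne
  rw [this, hneg]; ring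

lemma core {K : Set (Euc 2)} (hK : IsConvexBody K) (hcen : CentroidAtOrigin K) :
    ∃ S : Set (Euc 2), Convex ℝ S ∧ IsCompact S ∧ (∀ x ∈ S, -x ∈ S) ∧ 0 ∈ S ∧
      (∀ x ∈ S, x ∈ K ∨ -x ∈ K) ∧ volume.real K ≤ 9 / 8 * volume.real S := by
  have h0 := zero_int hK hcen
  obtain ⟨φ, a, c, hac, hp1, hp2, hs⟩ := setup hK hcen
  obtain ⟨hcv, hcp, hne⟩ := hK
  set K' : Set (ℝ × ℝ) := φ ⁻¹' K with hK'
  have hcv' : Convex ℝ K' := hcv.linear_preimage φ.toLinearEquiv.toLinearMap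
  have hcp' : IsCompact K' := φ.toHomeomorph.isCompact_preimage.mpr hcp
  set C : Set (ℝ × ℝ) := K' ∩ {p | 0 ≤ p.2} with hC
  have hCc : IsCompact C := hcp'.inter_right (isClosed_le continuous_const continuous_snd)
  have hSc := S_convex hcv' hac hp1 hp2 hs
  have hSv := S_vol hcp'
  rw [← hC] at hSc hSv
  -- measure scaling
  set ν : Measure (ℝ × ℝ) := Measure.map φ.symm volume with hν
  have : ν.IsAddHaarMeasure := ContinuousLinearEquiv.isAddHaarMeasure_map φ.symm volume
  obtain ⟨r, hr0, hrt, hr⟩ : ∃ r : ℝ≥0∞, r ≠ 0 ∧ r ≠ ∞ ∧ ν = r • volume := by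
    refine ⟨ν.addHaarScalarFactor volume, ?_, by simp, ?_⟩
    · have := Measure.addHaarScalarFactor_pos_of_isAddHaarMeasure ν volume
      simpa using this.ne'
    · exact Measure.isAddLeftInvariant_eq_smul ν volume
  have hemb : MeasurableEmbedding (⇑φ.symm) := φ.symm.toHomeomorph.measurableEmbedding
  have hvol : ∀ A : Set (ℝ × ℝ), volume (φ '' A) = r * volume A := by
    intro A
    have : ν A = volume (φ '' A) := by
      rw [hν, hemb.map_apply]
      congr 1
      ext x
      simp [ContinuousLinearEquiv.image_eq_preimage_symm]
    rw [← this, hr]; simp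
  have hvolr : ∀ A : Set (ℝ × ℝ), volume.real (φ '' A) = r.toReal * volume.real A := by
    intro A
    rw [Measure.real, hvol, ENNReal.toReal_mul]; rfl
  have hKim : φ '' K' = K := Set.image_preimage_eq _ φ.surjective
  have hcen' : ∫ p in K', p.2 = 0 := by
    have hint : IntegrableOn (fun x : Euc 2 => x) K :=
      continuous_id.continuousOn.integrableOn_compact hcp
    let f : Euc 2 →L[ℝ] ℝ := (ContinuousLinearMap.snd ℝ ℝ ℝ).comp (φ.symm : Euc 2 →L[ℝ] ℝ × ℝ)
    have h1 : ∫ x in K, f x = 0 := by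
      rw [ContinuousLinearMap.integral_comp_comm f hint, hcen, map_zero]
    have h2 : ∫ p in K', p.2 ∂ν = ∫ x in K, f x := by
      rw [hν, hemb.setIntegral_map]
      have : (⇑φ.symm) ⁻¹' K' = K := by
        ext x; simp [hK']
      rw [this]
      rfl
    rw [h1, hr, Measure.restrict_smul, integral_smul_measure] at h2
    have hrr : r.toReal ≠ 0 := (ENNReal.toReal_pos hr0 hrt).ne'
    exact (smul_eq_zero.mp h2).resolve_left hrr
  have hsl : 0 < sl K' 0 := by
    unfold sl
    have hcs : IsCompact {x : ℝ | (x, (0:ℝ)) ∈ K'} := slice_compact hcp' 0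
    have hsub : Icc (-1 : ℝ) 1 ⊆ {x : ℝ | (x, (0:ℝ)) ∈ K'} := by
      rintro x ⟨hx1, hx2⟩
      have := hcv' hp1 hp2 (a := (1 + x) / 2) (b := (1 - x) / 2) (by linarith) (by linarith) (by ring)
      have e : (x, (0 : ℝ)) = ((1 + x) / 2) • ((1 : ℝ), (0 : ℝ)) + ((1 - x) / 2) • ((-1 : ℝ), (0 : ℝ)) := by
        ext <;> simp; ring
      show (x, (0 : ℝ)) ∈ K'
      rw [e]; exact this
    have := measureReal_mono (μ := volume) hsub hcs.measure_lt_top.ne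
    rw [Real.volume_real_Icc_of_le (by norm_num)] at this
    linarith
  have hCpos : 0 < volume.real C := by
    have h0' : (0 : ℝ × ℝ) ∈ interior K' := by
      have : φ ⁻¹' (interior K) ⊆ interior K' := preimage_interior_subset_interior_preimage φ.continuous
      apply this
      simpa using h0
    have hop : IsOpen (interior K' ∩ {p : ℝ × ℝ | 0 < p.2}) :=
      isOpen_interior.inter (isOpen_lt continuous_const continuous_snd)
    have hnon : (interior K' ∩ {p : ℝ × ℝ | 0 < p.2}).Nonempty := by
      have ht : Tendsto (fun t : ℝ => ((0 : ℝ), t)) (nhdsWithin 0 (Ioi 0)) (nhds ((0:ℝ), (0:ℝ))) := by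
        apply Tendsto.mono_left _ nhdsWithin_le_nhds
        exact (Continuous.prodMk continuous_const continuous_id).tendsto' _ _ rfl
      have e1 := ht.eventually (isOpen_interior.mem_nhds h0')
      have e2 : ∀ᶠ t in nhdsWithin (0:ℝ) (Ioi 0), 0 < t := self_mem_nhdsWithin
      obtain ⟨t, ht1, ht2⟩ := (e1.and e2).exists
      exact ⟨(0, t), ht1, ht2⟩
    have hm : 0 < volume C := lt_of_lt_of_le (hop.measure_pos volume hnon)
      (measure_mono fun p hp => ⟨interior_subset hp.1, le_of_lt (show 0 < p.2 from hp.2)⟩)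
    exact ENNReal.toReal_pos hm.ne' hCc.measure_lt_top.ne
  have hG := grunbaum hcv' hcp' hsl hcen' hCpos
  rw [← hC] at hG
  refine ⟨φ '' (C ∪ -C), hSc.linear_image φ.toLinearEquiv.toLinearMap, (hCc.union hCc.neg).image φ.continuous, ?_, ?_, ?_, ?_⟩
  · rintro _ ⟨p, hp, rfl⟩
    refine ⟨-p, ?_, by simp⟩
    rcases hp with h | h
    · right; simpa using h
    · left; exact h
  · refine ⟨0, Or.inl ⟨?_, le_refl (0:ℝ)⟩, by simp⟩
    show φ 0 ∈ K
    rw [map_zero]; exact interior_subset h0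
  · rintro _ ⟨p, hp, rfl⟩
    rcases hp with h | h
    · left; exact h.1
    · right
      rw [← map_neg]; exact h.1
  · rw [hvolr, ← hSv, ← hKim, hvolr]
    have := ENNReal.toReal_nonneg (a := r)
    nlinarith

lemma lattice_sep (b : Fin 2 → Euc 2) (hb : LinearIndependent ℝ b) :
    ∃ M : ℝ, 0 < M ∧ ∀ x ∈ latticeOf b, x ≠ 0 → 1 ≤ M * ‖x‖ := by
  let B := basisOfLinearIndependentOfCardEqFinrank hb (by simp)
  let L : Euc 2 →L[ℝ] (Fin 2 → ℝ) := LinearMap.toContinuousLinearMap B.equivFun.toLinearMap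
  refine ⟨‖L‖ + 1, by positivity, ?_⟩
  rintro x ⟨z, hz⟩ hx0
  have hL : L x = fun i => (z i : ℝ) := by
    have : x = B.equivFun.symm (fun i => (z i : ℝ)) := by
      rw [hz, Module.Basis.equivFun_symm_apply]
      simp [B]
    rw [this]
    show B.equivFun (B.equivFun.symm _) = _
    exact LinearEquiv.apply_symm_apply _ _
  have hz0 : ∃ i, z i ≠ 0 := by
    by_contra h
    push Not at h
    apply hx0
    rw [hz]; simp [h]
  obtain ⟨i, hi⟩ := hz0
  have h1 : (1 : ℝ) ≤ ‖L x‖ := by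
    have := norm_le_pi_norm (L x) i
    rw [hL] at this ⊢
    refine le_trans ?_ this
    rw [Real.norm_eq_abs]
    have : (1 : ℤ) ≤ |z i| := Int.one_le_abs hi
    show (1 : ℝ) ≤ |(z i : ℝ)|
    exact_mod_cast this
  have h2 := L.le_opNorm x
  have := norm_nonneg x
  nlinarith

lemma neg_lattice {b : Fin 2 → Euc 2} {x : Euc 2} (h : x ∈ latticeOf b) : -x ∈ latticeOf b := by
  obtain ⟨z, hz⟩ := h
  refine ⟨fun i => - z i, ?_⟩
  rw [hz]; simp

lemma main_ineq (K : Set (Euc 2)) (hK : IsConvexBody K) (hcen : CentroidAtOrigin K)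
    (b : Fin 2 → Euc 2) (hb : LinearIndependent ℝ b) :
    (volume K).toReal / latticeDet b ≤
        (9 / 2 : ℝ) * (succMin K (latticeOf b) 1)⁻¹ * (succMin K (latticeOf b) 2)⁻¹ := by
  obtain ⟨S, hSc, hScp, hSs, hS0, hSK, hSv⟩ := core hK hcen
  have h0 := zero_int hK hcen
  obtain ⟨hcv, hcp, hne⟩ := hK
  have bdd : ∀ i, BddBelow {t : ℝ | 0 < t ∧ ∃ v : Fin i → Euc 2,
    LinearIndependent ℝ v ∧ ∀ j, v j ∈ latticeOf b ∧ v j ∈ t • K} := fun i => ⟨0, fun t ht => ht.1.le⟩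
  have sub : {t : ℝ | 0 < t ∧ ∃ v : Fin 2 → Euc 2,
      LinearIndependent ℝ v ∧ ∀ j, v j ∈ latticeOf b ∧ v j ∈ t • K} ⊆
      {t : ℝ | 0 < t ∧ ∃ v : Fin 1 → Euc 2,
      LinearIndependent ℝ v ∧ ∀ j, v j ∈ latticeOf b ∧ v j ∈ t • K} := by
    rintro t ⟨ht, v, hv, hm⟩
    refine ⟨ht, fun j => v (Fin.castLE one_le_two j), hv.comp _ (Fin.castLE_injective one_le_two), fun j => hm _⟩
  have bl : ∀ i, b i ∈ latticeOf b := by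
    intro i
    refine ⟨Pi.single i 1, ?_⟩
    fin_cases i <;> simp [Fin.sum_univ_two]
  have ne2 : {t : ℝ | 0 < t ∧ ∃ v : Fin 2 → Euc 2,
      LinearIndependent ℝ v ∧ ∀ j, v j ∈ latticeOf b ∧ v j ∈ t • K}.Nonempty := by
    obtain ⟨ε, hε, hball⟩ := Metric.isOpen_iff.mp isOpen_interior 0 h0
    set N := ‖b 0‖ + ‖b 1‖ + 1 with hN
    have hNp : 0 < N := by positivity
    have hNi : ∀ i, ‖b i‖ < N := by
      intro i
      have := norm_nonneg (b 0)
      have := norm_nonneg (b 1)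
      fin_cases i <;> simp [hN] <;> linarith
    have hp : 0 < N / ε := by positivity
    refine ⟨N / ε, hp, b, hb, fun j => ⟨bl j, ?_⟩⟩
    rw [Set.mem_smul_set_iff_inv_smul_mem₀ hp.ne']
    apply interior_subset
    apply hball
    rw [mem_ball_zero_iff, norm_smul, norm_inv, Real.norm_of_nonneg hp.le, inv_div]
    have := hNi j
    rw [div_mul_eq_mul_div, div_lt_iff₀ hNp]
    exact mul_lt_mul_of_pos_left this hε
  have l12 : succMin K (latticeOf b) 1 ≤ succMin K (latticeOf b) 2 :=
    csInf_le_csInf (bdd 1) ne2 sub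
  have l1 : 0 < succMin K (latticeOf b) 1 := by
    obtain ⟨M, hM, hMl⟩ := lattice_sep b hb
    obtain ⟨R, hR0, hR⟩ := hcp.isBounded.subset_closedBall_lt 0 0
    have hle : (M * R)⁻¹ ≤ succMin K (latticeOf b) 1 := by
      apply le_csInf (ne2.mono sub)
      rintro t ⟨ht, v, hv, hm⟩
      have h1 := hMl _ (hm 0).1 (hv.ne_zero 0)
      obtain ⟨y, hy, hyv⟩ := (hm 0).2
      have hy' : ‖y‖ ≤ R := by simpa using hR hy
      have hyv' : t • y = v 0 := hyv
      rw [← hyv', norm_smul, Real.norm_of_nonneg ht.le] at h1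
      rw [inv_le_iff_one_le_mul₀ (by positivity)]
      have : M * (t * ‖y‖) ≤ M * (t * R) := by gcongr
      linarith
    exact lt_of_lt_of_le (by positivity) hle
  have l2 : 0 < succMin K (latticeOf b) 2 := l1.trans_le l12
  have memS : ∀ (t : ℝ) (x : Euc 2), x ∈ t • S → x ∈ t • K ∨ -x ∈ t • K := by
    rintro t _ ⟨y, hy, rfl⟩
    rcases hSK y hy with h | h
    · exact Or.inl ⟨y, h, rfl⟩
    · exact Or.inr ⟨-y, h, by simp⟩
  have not_lt : ∀ (i : ℕ) (t : ℝ), 0 < t → t < succMin K (latticeOf b) i → ∀ v : Fin i → Euc 2,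
      LinearIndependent ℝ v → (∀ j, v j ∈ latticeOf b ∧ v j ∈ t • S) → False := by
    intro i t ht htl v hv hm
    have hex : ∀ j, ∃ e : ℝˣ, e • v j ∈ latticeOf b ∧ e • v j ∈ t • K := by
      intro j
      rcases memS t _ (hm j).2 with h | h
      · exact ⟨1, by rw [one_smul]; exact ⟨(hm j).1, h⟩⟩
      · refine ⟨-1, ?_⟩
        have : (-1 : ℝˣ) • v j = - v j := by simp
        rw [this]
        exact ⟨neg_lattice (hm j).1, h⟩
    choose e he using hex
    have hle : succMin K (latticeOf b) i ≤ t :=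
      csInf_le (bdd i) ⟨ht, e • v, hv.units_smul e, he⟩
    linarith
  set p := succMin K (latticeOf b) 1 with hp
  set q := succMin K (latticeOf b) 2 with hq
  have step : ∀ t : ℝ, 0 < t → t < 1 → (t * p) * (t * q) * volume.real S ≤ 4 * latticeDet b := by
    intro t ht ht1
    apply mink2 S hSc hScp hSs hS0 b hb (t * p) (t * q) (by positivity) (by gcongr)
    · intro w hw hw0 hwS
      refine not_lt 1 (t * p) (by positivity) (by rw [← hp]; nlinarith) (fun _ => w) ?_ (fun _ => ⟨hw, hwS⟩)
      exact LinearIndependent.of_subsingleton 0 hw0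
    · intro v hv hm
      exact not_lt 2 (t * q) (by positivity) (by rw [← hq]; nlinarith) v hv hm
  have lim : p * q * volume.real S ≤ 4 * latticeDet b := by
    have hc : Tendsto (fun t : ℝ => (t * p) * (t * q) * volume.real S) (nhdsWithin 1 (Iio 1))
        (nhds ((1 * p) * (1 * q) * volume.real S)) := by
      apply Tendsto.mono_left _ nhdsWithin_le_nhds
      apply Continuous.tendsto
      fun_prop
    have := le_of_tendsto hc (by
      have e1 : ∀ᶠ t in nhdsWithin (1:ℝ) (Iio 1), t < 1 := self_mem_nhdsWithin
      have e2 : ∀ᶠ t in nhdsWithin (1:ℝ) (Iio 1), 0 < t :=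
        nhdsWithin_le_nhds (lt_mem_nhds one_pos)
      filter_upwards [e1, e2] with t h1 h2
      exact step t h2 h1)
    simpa using this
  have hd : 0 ≤ latticeDet b := abs_nonneg _
  rcases hd.eq_or_lt with h | h
  · rw [← h, div_zero]; positivity
  · rw [div_le_iff₀ h]
    have e : (9 / 2 : ℝ) * p⁻¹ * q⁻¹ * latticeDet b = (9 / 2 * latticeDet b) / (p * q) := by
      field_simp
    rw [e, le_div_iff₀ (by positivity)]
    have hv : (volume K).toReal = volume.real K := rfl
    rw [hv]
    have : volume.real K * (p * q) ≤ 9 / 8 * volume.real S * (p * q) := by gcongr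
    linarith

/-- **Proposition (planar Ehrhart-type bound).** For a centred planar convex body,
`vol(K)/det Λ ≤ (9/2)·(1/λ_1)·(1/λ_2)`; for `Λ = ℤ²` equality holds for `T_2`. -/
theorem statement8 (K : Set (Euc 2)) (hK : IsConvexBody K) (hcen : CentroidAtOrigin K)
    (b : Fin 2 → Euc 2) (hb : LinearIndependent ℝ b) :
    (volume K).toReal / latticeDet b ≤
        (9 / 2 : ℝ) * (succMin K (latticeOf b) 1)⁻¹ * (succMin K (latticeOf b) 2)⁻¹ ∧
    (volume (Tn 2)).toReal =
        (9 / 2 : ℝ) * (succMin (Tn 2) (stdLattice 2) 1)⁻¹ *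
          (succMin (Tn 2) (stdLattice 2) 2)⁻¹ := by
  refine ⟨main_ineq K hK hcen b hb, ?_⟩
  rw [Tn_vol, Tn_min 1 (Or.inl rfl), Tn_min 2 (Or.inr rfl)]
  norm_num

end Paper
end
end

section
/- Let S ⊂ ℝ^n be an n-dimensional simplex with centroid at the origin and let Λ be a lattice of rank n in ℝ^n. Then vol(S)/det Λ ≤ ((n+1)^n/n!)·∏_{i=1}^n 1/λ_i(S,Λ). For Λ = ℤ^n, equality is attained by the simplex T_n = −𝟙 + (n+1)·conv{0, e_1, …, e_n}, where 𝟙 = (1,…,1)ᵀ. -/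
open MeasureTheory Set Filter Pointwise RealInnerProductSpace
open scoped ENNReal

noncomputable section

namespace Paper

variable {n : ℕ}

lemma core1 {n : ℕ} (L : (Fin n → ℝ) ≃ₗ[ℝ] (Fin n → ℝ)) (b : Module.Basis (Fin n) ℝ (Fin n → ℝ))
    (μ : ℕ → ℝ) (hpos : ∀ i, 0 < μ i) (hmono : Monotone μ)
    (h : ∀ v ∈ Submodule.span ℤ (Set.range b), ∀ i : Fin n, ‖L v‖ < μ i → v i = 0)
    (r : ℝ) (hr1 : r < 1) :
    ENNReal.ofReal (∏ i : Fin n, μ i) * volume {x : Fin n → ℝ | ‖L x‖ < r / 2} ≤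
      volume (ZSpan.fundamentalDomain b) := by
  classical
  set W : Set (Fin n → ℝ) := {x : Fin n → ℝ | ‖L x‖ < r / 2} with hW
  have hLc : Continuous L := LinearMap.continuous_of_finiteDimensional L.toLinearMap
  obtain ⟨K, hK0, hK⟩ : ∃ K : ℝ, 0 < K ∧ ∀ x, ‖L x‖ ≤ K * ‖x‖ := by
    have := ContinuousLinearMap.bound (LinearMap.toContinuousLinearMap L.toLinearMap)
    simpa using this
  obtain ⟨N, hN⟩ := exists_nat_gt (K / ((1 - r) / 2))
  have hr2 : 0 < (1 - r) / 2 := by linarith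
  have hN0 : (0 : ℝ) < N := lt_of_le_of_lt (by positivity) hN
  have hKN : K / N < (1 - r) / 2 := by
    rw [div_lt_iff₀ hr2] at hN
    rw [div_lt_iff₀ hN0]; linarith
  let d : ℕ → ℝ := fun k => if k = 0 then μ 0 else μ k - μ (k - 1)
  have hd0 : ∀ k, 0 ≤ d k := by
    intro k
    by_cases hk : k = 0
    · simp [d, hk, (hpos 0).le]
    · simp only [d, hk, if_false, sub_nonneg]; exact hmono (Nat.sub_le _ _)
  have hdsum : ∀ i, ∑ k ∈ Finset.range (i + 1), d k = μ i := by
    intro i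
    induction i with
    | zero => simp [d]
    | succ i ih => rw [Finset.sum_range_succ, ih]; simp [d]
  have hdsum' : ∀ i : Fin n, ∀ g : ℕ → ℝ, (∑ k ∈ Finset.range n, if k ≤ (i : ℕ) then d k * g k else 0)
      = ∑ k ∈ Finset.range (i + 1), d k * g k := by
    intro i g
    rw [← Finset.sum_filter]
    apply Finset.sum_congr _ (fun _ _ => rfl)
    ext k; have := i.2; simp; omega
  let fl : (Fin n → ℝ) → (Fin n → ℤ) := fun x j => ⌊(N : ℝ) * x j⌋
  let P : ℕ → (Fin n → ℤ) → (Fin n → ℝ) → Prop := fun k q w =>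
    w ∈ W ∧ ∀ j : Fin n, k ≤ (j : ℕ) → fl w j = q j
  let p : ℕ → (Fin n → ℤ) → (Fin n → ℝ) := fun k q => Classical.epsilon (P k q)
  have hp : ∀ k x, x ∈ W → P k (fl x) (p k (fl x)) := by
    intro k x hx
    exact Classical.epsilon_spec (p := P k (fl x)) ⟨x, hx, fun _ _ => rfl⟩
  have hptail : ∀ k q q', (∀ j : Fin n, k ≤ (j : ℕ) → q j = q' j) → p k q = p k q' := by
    intro k q q' hq
    have : P k q = P k q' := by
      funext w
      simp only [P, eq_iff_iff]
      refine and_congr Iff.rfl (forall_congr' fun j => forall_congr' fun hj => ?_)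
      rw [hq j hj]
    simp only [p, this]
  let c : ℕ → (Fin n → ℝ) → (Fin n → ℝ) := fun k x j => if k ≤ (j : ℕ) then x j else p k (fl x) j
  have hctail : ∀ k x y, (∀ j : Fin n, k ≤ (j : ℕ) → x j = y j) → c k x = c k y := by
    intro k x y hxy
    have : p k (fl x) = p k (fl y) := hptail _ _ _ fun j hj => by simp only [fl, hxy j hj]
    funext j
    simp only [c, this]
    split_ifs with hj
    · exact hxy j hj
    · rfl
  have hcn : ∀ k x, x ∈ W → ‖L (c k x)‖ < 1 / 2 := by
    intro k x hx
    obtain ⟨h1, h2⟩ := hp k x hx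
    have h3 : ‖c k x - p k (fl x)‖ ≤ 1 / N := by
      rw [pi_norm_le_iff_of_nonneg (by positivity)]
      intro j
      simp only [c, Pi.sub_apply]
      split_ifs with hj
      · have := h2 j hj
        simp only [fl] at this
        have h4 := Int.abs_sub_lt_one_of_floor_eq_floor this
        rw [← mul_sub, abs_mul, abs_of_pos hN0, abs_sub_comm] at h4
        rw [Real.norm_eq_abs, le_div_iff₀ hN0]; linarith
      · simp
    have h4 : L (c k x) = L (p k (fl x)) + L (c k x - p k (fl x)) := by rw [← map_add]; simp
    have h5 := hK (c k x - p k (fl x))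
    have h6 : K * ‖c k x - p k (fl x)‖ ≤ K / N := by
      calc _ ≤ K * (1 / N) := by gcongr
        _ = _ := by ring
    have h7 : ‖L (p k (fl x))‖ < r / 2 := h1
    rw [h4]
    have := norm_add_le (L (p k (fl x))) (L (c k x - p k (fl x)))
    linarith
  let φ : (Fin n → ℝ) → (Fin n → ℝ) := fun x => ∑ k ∈ Finset.range n, d k • c k x
  let A : (Fin n → ℤ) → (Fin n → ℝ) := fun q j =>
    ∑ k ∈ Finset.range n, if k ≤ (j : ℕ) then 0 else d k * p k q j
  have hφ : ∀ x j, φ x j = μ j * x j + A (fl x) j := by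
    intro x j
    have := hdsum' j (fun _ => x j)
    rw [← Finset.sum_mul, hdsum] at this
    rw [← this]
    simp only [φ, A, Finset.sum_apply, Pi.smul_apply, smul_eq_mul, c, ← Finset.sum_add_distrib]
    refine Finset.sum_congr rfl fun k _ => ?_
    split_ifs <;> simp
  have hAtail : ∀ q q' (i : Fin n), (∀ j : Fin n, i < j → q j = q' j) → A q i = A q' i := by
    intro q q' i hq
    refine Finset.sum_congr rfl fun k _ => ?_
    split_ifs with hk
    · rfl
    · rw [hptail k q q' fun j hj => hq j (by rw [Fin.lt_def]; omega)]
  -- triangularity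
  have htri : ∀ x y, ∀ i : ℕ, (∀ j : Fin n, i ≤ (j : ℕ) → φ x j = φ y j) →
      ∀ j : Fin n, i ≤ (j : ℕ) → x j = y j := by
    intro x y i hxy
    by_contra hcon
    push Not at hcon
    let s : Finset (Fin n) := Finset.univ.filter fun j => i ≤ (j : ℕ) ∧ x j ≠ y j
    have hs : s.Nonempty := by
      obtain ⟨j, hj⟩ := hcon
      exact ⟨j, by simpa [s] using hj⟩
    have hm := s.max'_mem hs
    set m := s.max' hs with hmdef
    simp only [s, Finset.mem_filter, Finset.mem_univ, true_and] at hm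
    have hgt : ∀ j : Fin n, m < j → x j = y j := by
      intro j hj
      by_contra hne
      have : j ∈ s := by
        simp only [s, Finset.mem_filter, Finset.mem_univ, true_and]
        exact ⟨hm.1.trans hj.le, hne⟩
      exact absurd (s.le_max' j this) (not_le.mpr hj)
    have e := hxy m hm.1
    rw [hφ, hφ, hAtail (fl x) (fl y) m fun j hj => by simp only [fl, hgt j hj]] at e
    apply hm.2
    have := hpos m
    have e' : μ m * x m = μ m * y m := by linarith
    exact mul_left_cancel₀ this.ne' e'
  have hinj : Function.Injective φ := by
    intro x y hxy
    funext j
    exact htri x y 0 (fun j _ => by rw [hxy]) j (Nat.zero_le _)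
  have hpack : ∀ x ∈ W, ∀ y ∈ W, φ x - φ y ∈ Submodule.span ℤ (Set.range b) → φ x - φ y = 0 := by
    intro x hx y hy hv
    by_contra hne
    set v := φ x - φ y with hvdef
    let s : Finset (Fin n) := Finset.univ.filter fun j => v j ≠ 0
    have hs : s.Nonempty := by
      by_contra hs
      apply hne
      funext j
      by_contra hj
      exact hs ⟨j, by simpa [s] using hj⟩
    have hm := s.max'_mem hs
    set m := s.max' hs with hmdef
    simp only [s, Finset.mem_filter, Finset.mem_univ, true_and] at hm
    have hgt : ∀ j : Fin n, m < j → v j = 0 := by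
      intro j hj
      by_contra hne
      have : j ∈ s := by
        simp only [s, Finset.mem_filter, Finset.mem_univ, true_and]
        exact hne
      exact absurd (s.le_max' j this) (not_le.mpr hj)
    have hxy : ∀ j : Fin n, (m : ℕ) + 1 ≤ j → x j = y j := by
      apply htri
      intro j hj
      have := hgt j (by rw [Fin.lt_def]; omega)
      simp only [hvdef, Pi.sub_apply] at this
      linarith
    apply hm
    apply h v hv m
    have e1 : v = ∑ k ∈ Finset.range (m + 1), d k • (c k x - c k y) := by
      have : Finset.range (m + 1) ⊆ Finset.range n := by
        exact Finset.range_subset_range.mpr m.2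
      rw [Finset.sum_subset this]
      · simp only [hvdef, φ, smul_sub, Finset.sum_sub_distrib]
      · intro k _ hk
        rw [hctail k x y fun j hj => hxy j (by simp at hk; omega)]
        simp
    rw [e1, map_sum, ← hdsum]
    calc _ ≤ ∑ k ∈ Finset.range (m + 1), ‖L (d k • (c k x - c k y))‖ := norm_sum_le _ _
      _ < _ := by
        have hlt : ∀ k, ‖L (c k x - c k y)‖ < 1 := by
          intro k
          rw [map_sub]
          have := norm_sub_le (L (c k x)) (L (c k y))
          have := hcn k x hx
          have := hcn k y hy
          linarith
        apply Finset.sum_lt_sum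
        · intro k _
          rw [map_smul, norm_smul, Real.norm_of_nonneg (hd0 k)]
          have := hlt k
          have := hd0 k
          nlinarith
        · refine ⟨0, by simp, ?_⟩
          rw [map_smul, norm_smul, Real.norm_of_nonneg (hd0 _)]
          have := hlt 0
          have h0 : 0 < d 0 := by simpa [d] using hpos 0
          nlinarith
  -- measure
  let D : (Fin n → ℝ) →ₗ[ℝ] (Fin n → ℝ) := Matrix.toLin' (Matrix.diagonal fun i : Fin n => μ i)
  have hD : ∀ x j, D x j = μ j * x j := by
    intro x j; simp [D, Matrix.mulVec_diagonal]
  have hDdet : LinearMap.det D = ∏ i : Fin n, μ i := by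
    simp [D]
  have hWm : MeasurableSet W := (isOpen_lt (hLc.norm) continuous_const).measurableSet
  have hflm : Measurable fl := by
    refine measurable_pi_lambda _ fun j => ?_
    exact Int.measurable_floor.comp ((measurable_pi_apply j).const_mul _)
  let C : (Fin n → ℤ) → Set (Fin n → ℝ) := fun q => W ∩ fl ⁻¹' {q}
  have hCm : ∀ q, MeasurableSet (C q) := fun q => hWm.inter (hflm (measurableSet_singleton q))
  have hφC : ∀ q, φ '' C q = (fun x => x + A q) '' (D '' C q) := by
    intro q
    rw [Set.image_image]
    apply Set.image_congr
    intro x hx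
    have : fl x = q := hx.2
    funext j
    rw [hφ, this, Pi.add_apply, hD]
  have hDinj : Function.Injective D := by
    intro x y hxy
    funext j
    have := congrFun hxy j
    rw [hD, hD] at this
    exact mul_left_cancel₀ (hpos j).ne' this
  have hCim : ∀ q, MeasurableSet (φ '' C q) := by
    intro q
    rw [hφC, Set.image_image]
    apply (hCm q).image_of_continuousOn_injOn
    · have : Continuous D := LinearMap.continuous_of_finiteDimensional D
      fun_prop
    · intro x _ y _ hxy
      exact hDinj (add_right_cancel hxy)
  have hCvol : ∀ q, volume (φ '' C q) = ENNReal.ofReal (∏ i : Fin n, μ i) * volume (C q) := by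
    intro q
    have hP : 0 ≤ ∏ i : Fin n, μ i := Finset.prod_nonneg fun i _ => (hpos i).le
    rw [hφC, Set.image_add_right, measure_preimage_add_right, Measure.addHaar_image_linearMap, hDdet,
      abs_of_nonneg hP]
  have hWU : W = ⋃ q, C q := by
    ext x; simp [C]
  have hCd : Pairwise (Function.onFun Disjoint C) := by
    intro q q' hqq
    refine Set.disjoint_left.mpr fun x hx hx' => hqq ?_
    exact hx.2.symm.trans hx'.2
  have hvolφ : volume (φ '' W) = ENNReal.ofReal (∏ i : Fin n, μ i) * volume W := by
    rw [hWU, Set.image_iUnion, measure_iUnion _ hCim, measure_iUnion hCd hCm, ← ENNReal.tsum_mul_left]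
    · exact tsum_congr hCvol
    · intro q q' hqq
      exact (Set.disjoint_image_iff hinj).mpr (hCd hqq)
  rw [← hvolφ]
  by_contra hcon
  push Not at hcon
  have hmeas : MeasurableSet (φ '' W) := by
    rw [hWU, Set.image_iUnion]; exact MeasurableSet.iUnion hCim
  have : Countable (Submodule.span ℤ (Set.range b)).toAddSubgroup :=
    inferInstanceAs (Countable (Submodule.span ℤ (Set.range b)))
  obtain ⟨x, y, hxy, hdis⟩ := exists_pair_mem_lattice_not_disjoint_vadd
    (L := (Submodule.span ℤ (Set.range b)).toAddSubgroup)
    (ZSpan.isAddFundamentalDomain' b volume) hmeas.nullMeasurableSet hcon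
  rw [Set.not_disjoint_iff] at hdis
  obtain ⟨z, ⟨a, ⟨x', hx', rfl⟩, ha⟩, ⟨a', ⟨y', hy', rfl⟩, ha'⟩⟩ := hdis
  have e : φ x' - φ y' = (y : Fin n → ℝ) - x := by
    have : (x : Fin n → ℝ) + φ x' = y + φ y' := ha.trans ha'.symm
    rw [sub_eq_sub_iff_add_eq_add]
    rw [add_comm, this]
  have := hpack x' hx' y' hy' (by rw [e]; exact Submodule.sub_mem _ y.2 x.2)
  rw [e, sub_eq_zero] at this
  exact hxy (Subtype.ext this.symm)

lemma core_s9 {n : ℕ} (L : (Fin n → ℝ) ≃ₗ[ℝ] (Fin n → ℝ)) (b : Module.Basis (Fin n) ℝ (Fin n → ℝ))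
    (μ : ℕ → ℝ) (hpos : ∀ i, 0 < μ i) (hmono : Monotone μ)
    (h : ∀ v ∈ Submodule.span ℤ (Set.range b), ∀ i : Fin n, ‖L v‖ < μ i → v i = 0) :
    ∏ i : Fin n, μ i ≤ |LinearMap.det (L : (Fin n → ℝ) →ₗ[ℝ] (Fin n → ℝ))| * |(Matrix.of b).det| := by
  set δ := |LinearMap.det (L : (Fin n → ℝ) →ₗ[ℝ] (Fin n → ℝ))| with hδ
  have hdet : LinearMap.det (L : (Fin n → ℝ) →ₗ[ℝ] (Fin n → ℝ)) ≠ 0 := L.isUnit_det'.ne_zero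
  have hδ0 : 0 < δ := abs_pos.mpr hdet
  have key : ∀ r : ℝ, r ∈ Set.Ioo (0 : ℝ) 1 → (∏ i : Fin n, μ i) * r ^ n ≤ δ * |(Matrix.of b).det| := by
    intro r hr
    have hP : 0 ≤ ∏ i : Fin n, μ i := Finset.prod_nonneg fun i _ => (hpos i).le
    have h1 := core1 L b μ hpos hmono h r hr.2
    have h2 : {x : Fin n → ℝ | ‖L x‖ < r / 2} =
        (L : (Fin n → ℝ) →ₗ[ℝ] (Fin n → ℝ)) ⁻¹' (Metric.ball 0 (r / 2)) := by
      ext x; simp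
    rw [h2, Measure.addHaar_preimage_linearMap _ hdet, Real.volume_pi_ball _ (by linarith [hr.1]),
      ZSpan.volume_fundamentalDomain, ← ENNReal.ofReal_mul (by positivity), ← ENNReal.ofReal_mul
        hP, ENNReal.ofReal_le_ofReal_iff (by positivity)] at h1
    rw [abs_inv, ← hδ, Fintype.card_fin, show 2 * (r / 2) = r by ring] at h1
    calc _ = δ * ((∏ i : Fin n, μ i) * (δ⁻¹ * r ^ n)) := by field_simp
      _ ≤ _ := by gcongr
  have hlim : Tendsto (fun r : ℝ => (∏ i : Fin n, μ i) * r ^ n) (nhdsWithin 1 (Set.Iio 1))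
      (nhds ((∏ i : Fin n, μ i) * 1 ^ n)) := by
    apply Tendsto.mono_left _ nhdsWithin_le_nhds
    exact (Continuous.tendsto (by fun_prop) 1)
  rw [one_pow, mul_one] at hlim
  apply le_of_tendsto hlim
  filter_upwards [Ioo_mem_nhdsLT (show (0 : ℝ) < 1 by norm_num)] with r hr using key r hr


lemma mem_stdSimplexSet {n : ℕ} (x : Euc n) :
    x ∈ stdSimplexSet n ↔ (∀ i, 0 ≤ x i) ∧ ∑ i, x i ≤ 1 := by
  constructor
  · intro hx
    have hc : Convex ℝ {x : Euc n | (∀ i, 0 ≤ x i) ∧ ∑ i, x i ≤ 1} := by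
      intro x hx y hy a b ha hb hab
      refine ⟨fun i => ?_, ?_⟩
      · have := hx.1 i
        have := hy.1 i
        simp only [PiLp.add_apply, PiLp.smul_apply, smul_eq_mul]
        positivity
      · simp only [PiLp.add_apply, PiLp.smul_apply, smul_eq_mul, Finset.sum_add_distrib,
          ← Finset.mul_sum]
        have h1 := hx.2
        have h2 := hy.2
        nlinarith
    refine convexHull_min ?_ hc hx
    rintro y (rfl | ⟨i, rfl⟩)
    · simp
    · refine ⟨fun j => ?_, ?_⟩
      · by_cases h : j = i <;> simp [h]
      · simp
  · rintro ⟨h0, h1⟩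
    have := (convex_convexHull ℝ (insert 0 (Set.range fun i : Fin n =>
      EuclideanSpace.single i (1 : ℝ)))).sum_mem (t := (Finset.univ : Finset (Fin (n + 1))))
      (w := Fin.cons (1 - ∑ i, x i) (fun i => x i))
      (z := Fin.cons 0 (fun i => EuclideanSpace.single i (1 : ℝ))) ?_ ?_ ?_
    · have e : x = ∑ i, Fin.cons (α := fun _ => ℝ) (1 - ∑ i, x i) (fun i => x i) i •
          Fin.cons (α := fun _ => Euc n) 0 (fun i => EuclideanSpace.single i (1 : ℝ)) i := by
        rw [Fin.sum_univ_succ]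
        ext j
        simp [Finset.sum_apply, Pi.single_apply]
      rw [e]
      exact this
    · intro i _
      refine Fin.cases ?_ (fun i => ?_) i
      · simpa using h1
      · simpa using h0 i
    · rw [Fin.sum_univ_succ]; simp
    · intro i _
      refine Fin.cases ?_ (fun i => ?_) i
      · exact subset_convexHull _ _ (by simp)
      · exact subset_convexHull _ _ (by simp)

lemma vol_corner (n : ℕ) : ∀ s : ℝ, 0 ≤ s →
    volume {y : Fin n → ℝ | (∀ i, 0 ≤ y i) ∧ ∑ i, y i ≤ s} = ENNReal.ofReal (s ^ n / n.factorial) := by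
  induction n with
  | zero =>
    intro s hs
    have : {y : Fin 0 → ℝ | (∀ i, 0 ≤ y i) ∧ ∑ i, y i ≤ s} = Set.univ := by
      ext y; simp [hs]
    rw [this]
    simp [volume_pi]
  | succ n ih =>
    intro s hs
    have hm : MeasurableSet {y : Fin (n + 1) → ℝ | (∀ i, 0 ≤ y i) ∧ ∑ i, y i ≤ s} := by
      apply IsClosed.measurableSet
      rw [Set.ofPred_and, Set.ofPred_forall]
      exact (isClosed_iInter fun i => isClosed_le continuous_const (continuous_apply i)).inter
        (isClosed_le (by fun_prop) continuous_const)
    have hmp := (volume_preserving_piFinSuccAbove (fun _ : Fin (n + 1) => ℝ) 0).symm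
    rw [← hmp.measure_preimage hm.nullMeasurableSet, Measure.volume_eq_prod,
      Measure.prod_apply (hmp.measurable hm)]
    have hsec : ∀ t : ℝ, volume (Prod.mk t ⁻¹' ((MeasurableEquiv.piFinSuccAbove
        (fun _ : Fin (n + 1) => ℝ) 0).symm ⁻¹' {y : Fin (n + 1) → ℝ | (∀ i, 0 ≤ y i) ∧ ∑ i, y i ≤ s}))
        = (Set.Icc 0 s).indicator (fun t => ENNReal.ofReal ((s - t) ^ n / n.factorial)) t := by
      intro t
      by_cases ht : t ∈ Set.Icc 0 s
      · rw [Set.indicator_of_mem ht, ← ih (s - t) (by linarith [ht.2])]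
        congr 1
        ext y
        simp only [MeasurableEquiv.piFinSuccAbove_symm_apply, Set.mem_preimage, Set.mem_ofPred_eq,
          Fin.insertNthEquiv, Equiv.coe_fn_mk, Fin.forall_fin_succ, Fin.sum_univ_succ]
        simp [ht.1]
        intro _
        constructor <;> intro h <;> linarith
      · rw [Set.indicator_of_notMem ht]
        convert measure_empty (μ := (volume : Measure (Fin n → ℝ)))
        ext y
        simp only [MeasurableEquiv.piFinSuccAbove_symm_apply, Set.mem_preimage, Set.mem_ofPred_eq,
          Fin.insertNthEquiv, Equiv.coe_fn_mk, Fin.forall_fin_succ, Fin.sum_univ_succ]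
        simp
        intro h0 h1
        have : 0 ≤ ∑ i, y i := Finset.sum_nonneg fun i _ => h1 i
        by_contra hcon
        exact ht ⟨h0, by linarith⟩
    simp_rw [hsec]
    rw [lintegral_indicator measurableSet_Icc, ← ofReal_integral_eq_lintegral_ofReal]
    · congr 1
      rw [integral_Icc_eq_integral_Ioc, ← intervalIntegral.integral_of_le hs]
      rw [intervalIntegral.integral_div, intervalIntegral.integral_comp_sub_left (fun x => x ^ n)]
      simp [Nat.factorial_succ]
      field_simp
    · exact (Continuous.integrableOn_Icc (by fun_prop))
    · filter_upwards [ae_restrict_mem measurableSet_Icc] with t ht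
      have : 0 ≤ s - t := by linarith [ht.2]
      positivity

lemma isCompact_stdSimplexSet (n : ℕ) : IsCompact (stdSimplexSet n) :=
  ((Set.finite_range _).insert _).isCompact_convexHull (𝕜 := ℝ)

lemma vol_stdSimplexSet (n : ℕ) :
    volume (stdSimplexSet n) = ENNReal.ofReal (1 / n.factorial) := by
  have h := vol_corner n 1 zero_le_one
  rw [one_pow] at h
  rw [← h, ← (EuclideanSpace.volume_preserving_symm_measurableEquiv_toLp (Fin n)).symm.measure_preimage_equiv]
  congr 1
  ext y
  rw [Set.mem_preimage, mem_stdSimplexSet]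
  rfl

lemma integral_affine {n : ℕ} {F : Type*} [NormedAddCommGroup F] [NormedSpace ℝ F]
    (A : Euc n →ₗ[ℝ] Euc n) (hA : Function.Injective A) (w : Euc n)
    (s : Set (Euc n)) (hs : MeasurableSet s) (g : Euc n → F) :
    ∫ x in (fun x => A x + w) '' s, g x = |LinearMap.det A| • ∫ x in s, g (A x + w) := by
  have hd : ∀ x ∈ s, HasFDerivWithinAt (fun x => A x + w) (LinearMap.toContinuousLinearMap A) s x := by
    intro x _
    exact ((LinearMap.toContinuousLinearMap A).hasFDerivAt.add_const w).hasFDerivWithinAt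
  rw [integral_image_eq_integral_abs_det_fderiv_smul volume hs hd]
  · rw [← integral_smul]; rfl
  · intro x _ y _ hxy
    exact hA (add_right_cancel hxy)

/-- linear map sending the standard basis to `w` -/
def mkLin {n : ℕ} (w : Fin n → Euc n) : Euc n →ₗ[ℝ] Euc n :=
  (EuclideanSpace.basisFun (Fin n) ℝ).toBasis.constr ℝ w

lemma mkLin_apply {n : ℕ} (w : Fin n → Euc n) (x : Euc n) : mkLin w x = ∑ i, x i • w i := by
  simp [mkLin, Module.Basis.constr_apply_fintype]

lemma mkLin_inj {n : ℕ} (w : Fin n → Euc n) (hw : LinearIndependent ℝ w) :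
    Function.Injective (mkLin w) := by
  rw [injective_iff_map_eq_zero]
  intro x hx
  rw [mkLin_apply] at hx
  ext i
  exact Fintype.linearIndependent_iff.mp hw _ hx i

lemma det_mkLin {n : ℕ} (w : Fin n → Euc n) : |LinearMap.det (mkLin w)| = latticeDet w := by
  rw [latticeDet, ← LinearMap.det_toMatrix (EuclideanSpace.basisFun (Fin n) ℝ).toBasis]
  congr 2
  ext i j
  simp [LinearMap.toMatrix_apply, mkLin]

/-- linear part of the reflection of the simplex -/
def refl {n : ℕ} (i : Fin n) : Euc n →ₗ[ℝ] Euc n :=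
  mkLin fun j => EuclideanSpace.single j (1 : ℝ) -
    (if j = i then (2 : ℝ) else 1) • EuclideanSpace.single i (1 : ℝ)

lemma refl_apply {n : ℕ} (i : Fin n) (x : Euc n) (j : Fin n) :
    refl i x j = if j = i then - ∑ k, x k + x i - x i else x j := by
  rw [refl, mkLin_apply]
  simp only [WithLp.ofLp_sum, Finset.sum_apply, PiLp.smul_apply, PiLp.sub_apply, smul_eq_mul,
    PiLp.single_apply, mul_sub, Finset.sum_sub_distrib]
  split_ifs with h
  · subst h
    have : ∀ k, x k * ((if k = j then (2 : ℝ) else 1) * 1) = x k + if j = k then x k else 0 := by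
      intro k; by_cases hk : k = j
      · subst hk; simp; ring
      · simp [hk, Ne.symm hk]
    simp only [this, Finset.sum_add_distrib]
    simp
  · simp [h]

lemma sum_refl {n : ℕ} (i : Fin n) (x : Euc n) : ∑ k, refl i x k = - x i := by
  simp only [refl_apply]
  have : ∀ k, (if k = i then - ∑ k, x k + x i - x i else x k) =
      x k + if k = i then -∑ k, x k - x i else 0 := by
    intro k; by_cases hk : k = i
    · subst hk; simp
    · simp [hk]
  simp_rw [this]
  rw [Finset.sum_add_distrib]
  simp
  ring

lemma refl_refl {n : ℕ} (i : Fin n) (x : Euc n) : refl i (refl i x) = x := by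
  ext j
  rw [refl_apply, sum_refl]
  simp only [refl_apply]
  split_ifs with h
  · subst h; simp
  · rfl

lemma det_refl {n : ℕ} (i : Fin n) : |LinearMap.det (refl i)| = 1 := by
  have : refl i ∘ₗ refl i = LinearMap.id := by
    ext1 x; exact refl_refl i x
  have h := congrArg LinearMap.det this
  rw [LinearMap.det_comp, LinearMap.det_id] at h
  rcases mul_self_eq_one_iff.mp h with h | h <;> simp [h]

lemma integrableOn_simplex {n : ℕ} {F : Type*} [NormedAddCommGroup F]
    (f : Euc n → F) (hf : Continuous f) :
    IntegrableOn f (stdSimplexSet n) volume :=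
  hf.continuousOn.integrableOn_compact (isCompact_stdSimplexSet n)

lemma integral_coord {n : ℕ} (i : Fin n) :
    ∫ x in stdSimplexSet n, x i = ∫ x in stdSimplexSet n, (1 - ∑ k, x k) := by
  have him : (fun x => refl i x + EuclideanSpace.single i (1 : ℝ)) '' stdSimplexSet n
      = stdSimplexSet n := by
    have hsub : ∀ x ∈ stdSimplexSet n, refl i x + EuclideanSpace.single i (1 : ℝ) ∈ stdSimplexSet n := by
      intro x hx
      rw [mem_stdSimplexSet] at hx ⊢
      refine ⟨fun j => ?_, ?_⟩
      · rw [PiLp.add_apply, refl_apply]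
        by_cases h : j = i
        · subst h; simp; linarith [hx.2]
        · simp [h, hx.1 j]
      · simp only [PiLp.add_apply, Finset.sum_add_distrib, sum_refl]
        simp [hx.1 i]
    apply Set.Subset.antisymm
    · rintro _ ⟨x, hx, rfl⟩
      exact hsub x hx
    · intro x hx
      refine ⟨_, hsub x hx, ?_⟩
      simp only [map_add, refl_refl]
      have : refl i (EuclideanSpace.single i (1 : ℝ)) = - EuclideanSpace.single i (1 : ℝ) := by
        ext j
        rw [refl_apply]
        by_cases h : j = i
        · subst h; simp
        · simp [h]
      rw [this]; simp
  have hinj : Function.Injective (refl i) := Function.LeftInverse.injective (refl_refl i)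
  have := integral_affine (refl i) hinj (EuclideanSpace.single i (1 : ℝ)) (stdSimplexSet n)
    (isCompact_stdSimplexSet n).measurableSet (fun x => x i)
  rw [him, det_refl, one_smul] at this
  rw [this]
  congr 1
  ext x
  simp [refl_apply]
  ring

lemma vol_simplex_pos (n : ℕ) : 0 < volume.real (stdSimplexSet n) := by
  rw [Measure.real, vol_stdSimplexSet, ENNReal.toReal_ofReal (by positivity)]
  positivity

lemma integral_simplex (n : ℕ) :
    ∫ x in stdSimplexSet n, x = (volume.real (stdSimplexSet n) / (n + 1)) • allOnes n := by
  have hcoord : ∀ i, ∫ x in stdSimplexSet n, x i = volume.real (stdSimplexSet n) / (n + 1) := by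
    intro i
    have h1 : ∫ x in stdSimplexSet n, (1 - ∑ k, x k) =
        volume.real (stdSimplexSet n) - ∑ k, ∫ x in stdSimplexSet n, x k := by
      rw [integral_sub, integral_finsetSum]
      · simp
      · intro k _
        exact integrableOn_simplex (fun x => x k) (by fun_prop)
      · exact integrableOn_simplex (fun x => (1 : ℝ)) (by fun_prop)
      · exact integrableOn_simplex (fun x => ∑ k, x k) (by fun_prop)
    have h2 : ∀ k, ∫ x in stdSimplexSet n, x k = ∫ x in stdSimplexSet n, x i := by
      intro k; rw [integral_coord k, integral_coord i]
    rw [← integral_coord i] at h1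
    simp_rw [h2] at h1
    simp at h1
    field_simp
    linarith
  ext i
  have := (EuclideanSpace.proj i : Euc n →L[ℝ] ℝ).integral_comp_comm
    (integrableOn_simplex (fun x : Euc n => x) continuous_id)
  simp only [EuclideanSpace.coe_proj] at this
  rw [← this, hcoord]
  simp [allOnes]

lemma mem_Tn {n : ℕ} (x : Euc n) : x ∈ Tn n ↔ (∀ i, -1 ≤ x i) ∧ ∑ i, x i ≤ 1 := by
  have hn : (0 : ℝ) < (n : ℝ) + 1 := by positivity
  constructor
  · rintro ⟨y, hy, rfl⟩
    rw [mem_stdSimplexSet] at hy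
    refine ⟨fun i => ?_, ?_⟩
    · have := hy.1 i
      simp [allOnes]
      positivity
    · simp [allOnes, ← Finset.mul_sum]
      nlinarith [hy.2]
  · rintro ⟨h0, h1⟩
    refine ⟨((n : ℝ) + 1)⁻¹ • (x + allOnes n), ?_, ?_⟩
    · rw [mem_stdSimplexSet]
      refine ⟨fun i => ?_, ?_⟩
      · have := h0 i
        have h3 : 0 ≤ x i + 1 := by linarith
        have h4 : 0 ≤ ((n : ℝ) + 1)⁻¹ * (x i + 1) := by positivity
        exact h4
      · simp [allOnes, ← Finset.mul_sum, Finset.sum_add_distrib]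
        rw [mul_comm (n : ℝ), ← mul_add, inv_mul_le_iff₀ hn]; linarith
    · simp only [smul_smul, mul_inv_cancel₀ hn.ne', one_smul, add_sub_cancel_right]

lemma vol_Tn (n : ℕ) : volume (Tn n) = ENNReal.ofReal (((n : ℝ) + 1) ^ n / n.factorial) := by
  have : Tn n = (fun x => x + (- allOnes n)) '' (((n : ℝ) + 1) • stdSimplexSet n) := by
    rw [← Set.image_smul, Set.image_image]
    rfl
  rw [this, Set.image_add_right, measure_preimage_add_right, Measure.addHaar_smul, vol_stdSimplexSet,
    ← ENNReal.ofReal_mul (by positivity), finrank_euclideanSpace_fin, abs_of_nonneg (by positivity)]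
  congr 1
  ring

lemma exists_B {n : ℕ} (v : Fin (n + 1) → Euc n)
    (hv : AffineIndependent ℝ v) (S : Set (Euc n))
    (hS : S = convexHull ℝ (Set.range v)) (hcen : CentroidAtOrigin S) :
    ∃ B : Euc n →ₗ[ℝ] Euc n, Function.Injective B ∧ S = B '' Tn n := by
  have hn : (0 : ℝ) < (n : ℝ) + 1 := by positivity
  let w : Fin n → Euc n := fun i => v i.succ - v 0
  have hw : LinearIndependent ℝ w := by
    have := (affineIndependent_iff_linearIndependent_vsub ℝ v 0).mp hv
    exact this.comp (fun i : Fin n => (⟨i.succ, Fin.succ_ne_zero i⟩ : {x : Fin (n + 1) // x ≠ 0}))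
      (fun i j hij => by simpa using hij)
  let A := mkLin w
  have hA : Function.Injective A := mkLin_inj w hw
  have hSA : S = (fun x => A x + v 0) '' stdSimplexSet n := by
    let f : Euc n →ᵃ[ℝ] Euc n := A.toAffineMap + AffineMap.const ℝ _ (v 0)
    have hf : (fun x => A x + v 0) = f := by ext1 x; simp [f]
    rw [hf, stdSimplexSet, AffineMap.image_convexHull, hS]
    congr 1
    rw [Set.image_insert_eq, ← Set.range_comp, ← hf]
    ext y
    simp only [Set.mem_range, Set.mem_insert_iff, Fin.exists_fin_succ, Function.comp]
    have h1 : ∀ i, A (EuclideanSpace.single i (1 : ℝ)) + v 0 = v i.succ := by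
      intro i
      simp only [A, mkLin_apply]
      simp [w, Pi.single_apply]
    simp only [h1]
    simp [eq_comm]
  have hdet : |LinearMap.det A| ≠ 0 := by
    rw [abs_ne_zero]
    exact ((LinearMap.isUnit_iff_isUnit_det A).mp
      ((Module.End.isUnit_iff A).mpr ⟨hA, LinearMap.injective_iff_surjective.mp hA⟩)).ne_zero
  have hv0 : v 0 = - ((n : ℝ) + 1)⁻¹ • A (allOnes n) := by
    rw [CentroidAtOrigin, hSA, integral_affine A hA _ _ (isCompact_stdSimplexSet n).measurableSet,
      smul_eq_zero, or_iff_right hdet, integral_add] at hcen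
    · have hcomm := (LinearMap.toContinuousLinearMap A).integral_comp_comm
        (integrableOn_simplex (fun x : Euc n => x) continuous_id)
      simp only [LinearMap.coe_toContinuousLinearMap'] at hcomm
      rw [hcomm, integral_simplex, map_smul] at hcen
      simp only [integral_const, measureReal_restrict_apply_univ] at hcen
      have hp := vol_simplex_pos n
      set V := volume.real (stdSimplexSet n)
      have h2 : V • (((n : ℝ) + 1)⁻¹ • A (allOnes n) + v 0) = 0 := by
        rw [smul_add, smul_smul, ← div_eq_mul_inv]; exact hcen
      rw [smul_eq_zero, or_iff_right hp.ne'] at h2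
      rw [neg_smul]
      exact (neg_eq_of_add_eq_zero_right h2).symm
    · exact integrableOn_simplex _ (LinearMap.continuous_of_finiteDimensional A)
    · exact integrableOn_simplex _ continuous_const
  refine ⟨((n : ℝ) + 1)⁻¹ • A, ?_, ?_⟩
  · intro x y hxy
    simp only [LinearMap.smul_apply] at hxy
    exact hA (smul_right_injective _ (inv_ne_zero hn.ne') hxy)
  · rw [hSA, Tn, Set.image_image]
    apply Set.image_congr
    intro x _
    rw [hv0]
    simp only [LinearMap.smul_apply, map_sub, map_smul, smul_sub, smul_smul, mul_inv_cancel₀ hn.ne',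
      one_smul, neg_smul]
    rw [sub_eq_add_neg]


lemma greedy {n : ℕ} (W : ℕ → Submodule ℝ (Euc n)) (m : ℕ)
    (hW : ∀ k < m, k + 1 ≤ Module.finrank ℝ (W k)) :
    ∃ w : Fin m → Euc n, LinearIndependent ℝ w ∧ ∀ k : Fin m, w k ∈ W k := by
  induction m with
  | zero => exact ⟨Fin.elim0, linearIndependent_empty_type, fun k => k.elim0⟩
  | succ m ih =>
    obtain ⟨w, hw, hmem⟩ := ih fun k hk => hW k (by omega)
    have hne : ∃ x ∈ W m, x ∉ Submodule.span ℝ (Set.range w) := by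
      by_contra hcon
      push Not at hcon
      have h1 := Submodule.finrank_mono (show W m ≤ Submodule.span ℝ (Set.range w) from hcon)
      have h2 := finrank_span_eq_card hw
      have h3 := hW m (by omega)
      rw [Fintype.card_fin] at h2
      omega
    obtain ⟨x, hx, hxs⟩ := hne
    refine ⟨Fin.snoc w x, linearIndependent_finSnoc.mpr ⟨hw, hxs⟩, fun k => ?_⟩
    refine Fin.lastCases ?_ (fun k => ?_) k
    · simpa using hx
    · simpa using hmem k

lemma mem_smul_image {n : ℕ} (B : Euc n ≃ₗ[ℝ] Euc n) {t : ℝ} (ht : 0 < t) (x : Euc n) :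
    x ∈ t • (B '' Tn n) ↔ (∀ i, -t ≤ B.symm x i) ∧ ∑ i, B.symm x i ≤ t := by
  rw [Set.mem_smul_set_iff_inv_smul_mem₀ ht.ne', LinearEquiv.image_eq_preimage_symm, Set.mem_preimage,
    mem_Tn, map_smul]
  simp only [PiLp.smul_apply, smul_eq_mul, ← Finset.mul_sum]
  refine and_congr (forall_congr' fun i => ?_) ?_
  · rw [← neg_one_mul t, mul_comm _ (B.symm x i), ← div_eq_mul_inv, le_div_iff₀ ht]
  · rw [inv_mul_le_iff₀ ht, mul_one]

lemma isCompact_Tn (n : ℕ) : IsCompact (Tn n) :=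
  (isCompact_stdSimplexSet n).image (by fun_prop)

lemma mem_latticeOf_mkLin {n : ℕ} (b : Fin n → Euc n) (v : Euc n) :
    v ∈ latticeOf b ↔ ∃ z : Euc n, (∀ i, ∃ m : ℤ, z i = m) ∧ v = mkLin b z := by
  constructor
  · rintro ⟨z, rfl⟩
    exact ⟨WithLp.toLp 2 fun i => (z i : ℝ), fun i => ⟨z i, rfl⟩, by rw [mkLin_apply]⟩
  · rintro ⟨z, hz, rfl⟩
    choose m hm using hz
    exact ⟨m, by rw [mkLin_apply]; simp only [hm]⟩

lemma neg_mem_latticeOf {n : ℕ} (b : Fin n → Euc n) (v : Euc n) (hv : v ∈ latticeOf b) :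
    -v ∈ latticeOf b := by
  obtain ⟨z, rfl⟩ := hv
  exact ⟨fun i => - z i, by simp⟩

lemma exists_eps {n : ℕ} (b : Fin n → Euc n) (hb : LinearIndependent ℝ b) (S : Set (Euc n))
    (hS : IsCompact S) : ∃ ε : ℝ, 0 < ε ∧ ∀ v ∈ latticeOf b, v ≠ 0 → ∀ t : ℝ, 0 < t → v ∈ t • S → ε ≤ t := by
  let M : Euc n ≃ₗ[ℝ] Euc n := LinearEquiv.ofInjectiveEndo (mkLin b) (mkLin_inj b hb)
  obtain ⟨K, hK0, hK⟩ : ∃ K : ℝ, 0 < K ∧ ∀ x, ‖M.symm x‖ ≤ K * ‖x‖ := by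
    have := ContinuousLinearMap.bound (LinearMap.toContinuousLinearMap M.symm.toLinearMap)
    simpa using this
  obtain ⟨R, hR0, hR⟩ := hS.isBounded.exists_pos_norm_le
  refine ⟨1 / (K * R), by positivity, ?_⟩
  intro v hv hv0 t ht hvt
  obtain ⟨z, hz, rfl⟩ := (mem_latticeOf_mkLin b v).mp hv
  obtain ⟨s, hs, hst⟩ := hvt
  have h1 : ‖mkLin b z‖ ≤ t * R := by
    rw [← hst]
    simp only [norm_smul, Real.norm_of_nonneg ht.le]
    gcongr
    exact hR s hs
  have h2 : ‖z‖ ≤ K * ‖mkLin b z‖ := by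
    have h3 := hK (mkLin b z)
    have h4 : M.symm (mkLin b z) = z := M.symm_apply_apply z
    rwa [h4] at h3
  have h3 : 1 ≤ ‖z‖ := by
    have : ∃ i, z i ≠ 0 := by
      by_contra hcon
      push Not at hcon
      apply hv0
      have : z = 0 := by ext i; exact hcon i
      rw [this, map_zero]
    obtain ⟨i, hi⟩ := this
    obtain ⟨m, hm⟩ := hz i
    refine le_trans ?_ (PiLp.norm_apply_le z i)
    rw [hm] at hi ⊢
    rw [Real.norm_eq_abs]
    have hm0 : m ≠ 0 := fun h => hi (by rw [h]; simp)
    exact_mod_cast Int.one_le_abs hm0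
  rw [div_le_iff₀ (by positivity)]
  calc 1 ≤ K * ‖mkLin b z‖ := h3.trans h2
    _ ≤ K * (t * R) := by gcongr
    _ = _ := by ring

lemma mono_smul {n : ℕ} (B : Euc n ≃ₗ[ℝ] Euc n) {t t' : ℝ} (ht : 0 < t) (htt : t ≤ t') (x : Euc n)
    (hx : x ∈ t • (B '' Tn n)) : x ∈ t' • (B '' Tn n) := by
  rw [mem_smul_image B ht] at hx
  rw [mem_smul_image B (ht.trans_le htt)]
  exact ⟨fun i => by linarith [hx.1 i], by linarith [hx.2]⟩

lemma cube_subset {n : ℕ} (B : Euc n ≃ₗ[ℝ] Euc n) {t : ℝ} (ht : 0 < t) (x : Euc n)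
    (hx : ∀ i, |B.symm x i| ≤ t) : x ∈ t • (B '' Tn n) ∨ -x ∈ t • (B '' Tn n) := by
  rw [mem_smul_image B ht, mem_smul_image B ht]
  simp only [map_neg, PiLp.neg_apply, Finset.sum_neg_distrib]
  rcases le_total (∑ i, B.symm x i) 0 with h | h
  · left
    exact ⟨fun i => (abs_le.mp (hx i)).1, by linarith⟩
  · right
    exact ⟨fun i => by linarith [(abs_le.mp (hx i)).2], by linarith⟩

/-- The set whose infimum is the successive minimum. -/
def smSet {n : ℕ} (K Λ : Set (Euc n)) (i : ℕ) : Set ℝ :=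
  {t : ℝ | 0 < t ∧ ∃ v : Fin i → Euc n, LinearIndependent ℝ v ∧ ∀ j, v j ∈ Λ ∧ v j ∈ t • K}

lemma smSet_nonempty {n : ℕ} (B : Euc n ≃ₗ[ℝ] Euc n) (b : Fin n → Euc n)
    (hb : LinearIndependent ℝ b) (i : ℕ) (hi : i ≤ n) :
    (smSet (B '' Tn n) (latticeOf b) i).Nonempty := by
  let T : Fin n → ℝ := fun j => 1 + ∑ k, |B.symm (b j) k|
  have hT : ∀ j, 0 < T j := fun j => by
    have : 0 ≤ ∑ k, |B.symm (b j) k| := Finset.sum_nonneg fun k _ => abs_nonneg _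
    simp only [T]; linarith
  have h0 : 0 < 1 + ∑ j, T j := by
    have : 0 ≤ ∑ j, T j := Finset.sum_nonneg fun k _ => (hT k).le
    linarith
  refine ⟨1 + ∑ j, T j, h0, fun j => b (Fin.castLE hi j), hb.comp _ (Fin.castLE_injective hi), ?_⟩
  intro j
  set j' := Fin.castLE hi j
  refine ⟨⟨Pi.single j' 1, ?_⟩, ?_⟩
  · simp [Pi.single_apply]
    rfl
  · apply mono_smul B (hT j')
    · have := Finset.single_le_sum (fun k _ => (hT k).le) (Finset.mem_univ j')
      linarith
    · rw [mem_smul_image B (hT j')]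
      constructor
      · intro k
        have h1 := Finset.single_le_sum (f := fun k => |B.symm (b j') k|)
          (fun k _ => abs_nonneg _) (Finset.mem_univ k)
        have h2 := neg_abs_le (B.symm (b j') k)
        simp only [T]
        simp only at h1
        linarith
      · have h1 := Finset.sum_le_sum (s := Finset.univ) fun k _ => le_abs_self (B.symm (b j') k)
        simp only [T]
        linarith

lemma main_ineq_s9 {n : ℕ} (hn : 0 < n) (B : Euc n ≃ₗ[ℝ] Euc n) (b : Fin n → Euc n)
    (hb : LinearIndependent ℝ b) :
    (∀ i : Fin n, 0 < succMin (B '' Tn n) (latticeOf b) ((i : ℕ) + 1)) ∧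
    |LinearMap.det (B : Euc n →ₗ[ℝ] Euc n)| * ∏ i : Fin n, succMin (B '' Tn n) (latticeOf b) ((i : ℕ) + 1)
      ≤ latticeDet b := by
  set S := B '' Tn n with hSdef
  set Λ := latticeOf b with hΛ
  have hSc : IsCompact S :=
    (isCompact_Tn n).image (LinearMap.continuous_of_finiteDimensional B.toLinearMap)
  obtain ⟨ε, hε, hεt⟩ := exists_eps b hb S hSc
  have hbdd : ∀ i, BddBelow (smSet S Λ i) := fun i => ⟨0, fun t ht => ht.1.le⟩
  have hspos : ∀ i, i < n → 0 < succMin S Λ (i + 1) := by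
    intro i hi
    refine lt_of_lt_of_le hε (le_csInf (smSet_nonempty B b hb (i + 1) hi) ?_)
    rintro t ⟨ht, v, hv, hvm⟩
    exact hεt (v 0) (hvm 0).1 (hv.ne_zero 0) t ht (hvm 0).2
  refine ⟨fun i => hspos i i.2, ?_⟩
  let μ : ℕ → ℝ := fun k => succMin S Λ (min k (n - 1) + 1)
  have hμ : ∀ i : Fin n, μ i = succMin S Λ ((i : ℕ) + 1) := by
    intro i
    have : min (i : ℕ) (n - 1) = i := by have := i.2; omega
    simp only [μ, this]
  have hpos : ∀ i, 0 < μ i := fun i => hspos _ (by omega)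
  have hmono : Monotone μ := by
    intro i j hij
    refine csInf_le_csInf (hbdd _) (smSet_nonempty B b hb _ (by omega)) ?_
    rintro t ⟨ht, v, hv, hvm⟩
    have hle : min i (n - 1) + 1 ≤ min j (n - 1) + 1 := by omega
    exact ⟨ht, fun k => v (Fin.castLE hle k), hv.comp _ (Fin.castLE_injective hle), fun k => hvm _⟩
  let G : ℕ → Set (Euc n) := fun i => {v | v ∈ Λ ∧ ∃ t, 0 < t ∧ t < μ i ∧ v ∈ t • S}
  let U : ℕ → Submodule ℝ (Euc n) := fun i => Submodule.span ℝ (G i)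
  have hU : ∀ i < n, Module.finrank ℝ (U i) ≤ i := by
    intro i hi
    by_contra hcon
    push Not at hcon
    obtain ⟨f, hf, -, hfi⟩ := Submodule.exists_fun_fin_finrank_span_eq ℝ (G i)
    have hle : i + 1 ≤ Module.finrank ℝ (U i) := hcon
    have hfm : ∀ k, ∃ t, 0 < t ∧ t < μ i ∧ f k ∈ t • S := fun k => (hf k).2
    choose T hT0 hT1 hT2 using hfm
    let g : Fin (i + 1) → Fin (Module.finrank ℝ (U i)) := Fin.castLE hle
    let t := Finset.univ.sup' (Finset.univ_nonempty) (fun k => T (g k))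
    have ht : ∀ k, T (g k) ≤ t := fun k => Finset.le_sup' (fun k => T (g k)) (Finset.mem_univ k)
    have htμ : t < μ i := by
      rw [Finset.sup'_lt_iff]
      exact fun k _ => hT1 _
    have hmem : t ∈ smSet S Λ (i + 1) := by
      refine ⟨(hT0 _).trans_le (ht 0), fun k => f (g k), hfi.comp _ (Fin.castLE_injective hle), ?_⟩
      intro k
      exact ⟨(hf _).1, mono_smul B (hT0 _) (ht k) _ (hT2 _)⟩
    have h1 : succMin S Λ (i + 1) ≤ t := csInf_le (hbdd _) hmem
    have h2 := hμ ⟨i, hi⟩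
    simp only at h2
    linarith
  obtain ⟨w, hw, hwm⟩ := greedy (fun k => (U (n - 1 - k))ᗮ) n (by
    intro k hk
    have h1 := hU (n - 1 - k) (by omega)
    have h2 := Submodule.finrank_add_finrank_orthogonal (U (n - 1 - k))
    rw [finrank_euclideanSpace_fin] at h2
    omega)
  let Ξ₀ : Euc n →ₗ[ℝ] (Fin n → ℝ) := LinearMap.pi fun i => (innerSL ℝ (w i.rev)).toLinearMap
  have hΞ₀ : ∀ x i, Ξ₀ x i = ⟪w i.rev, x⟫ := fun x i => rfl
  have hΞinj : Function.Injective Ξ₀ := by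
    rw [injective_iff_map_eq_zero]
    intro x hx
    have hspan : Submodule.span ℝ (Set.range w) = ⊤ :=
      hw.span_eq_top_of_card_eq_finrank' (by simp)
    have h1 : ∀ y ∈ Submodule.span ℝ (Set.range w), ⟪y, x⟫ = 0 := by
      intro y hy
      induction hy using Submodule.span_induction with
      | mem y hy =>
        obtain ⟨i, rfl⟩ := hy
        have := congrFun hx i.rev
        rw [hΞ₀, Fin.rev_rev] at this
        exact this
      | zero => simp
      | add y z _ _ h1 h2 => rw [inner_add_left, h1, h2, add_zero]
      | smul a y _ h1 => rw [inner_smul_left, h1, mul_zero]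
    have h2 := h1 x (by rw [hspan]; trivial)
    exact inner_self_eq_zero.mp h2
  let Ξ : Euc n ≃ₗ[ℝ] (Fin n → ℝ) := LinearEquiv.ofInjectiveOfFinrankEq Ξ₀ hΞinj (by simp)
  have hΞ : ∀ x i, Ξ x i = ⟪w i.rev, x⟫ := fun x i => rfl
  let bb : Module.Basis (Fin n) ℝ (Euc n) := basisOfLinearIndependentOfCardEqFinrank' b hb (by simp)
  let b2 : Module.Basis (Fin n) ℝ (Fin n → ℝ) := bb.map Ξ
  have hb2 : ∀ i, b2 i = Ξ (b i) := by intro i; simp [b2, bb]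
  let L : (Fin n → ℝ) ≃ₗ[ℝ] (Fin n → ℝ) := (Ξ.symm.trans B.symm).trans (WithLp.linearEquiv 2 ℝ (Fin n → ℝ))
  have hL : ∀ x j, L (Ξ x) j = B.symm x j := by
    intro x j
    simp [L]
  have hcore := core_s9 L b2 μ hpos hmono (by
    intro v hv i hvi
    obtain ⟨u, hu, rfl⟩ : ∃ u ∈ Λ, Ξ u = v := by
      rw [Submodule.mem_span_range_iff_exists_fun] at hv
      obtain ⟨z, rfl⟩ := hv
      refine ⟨∑ i, (z i : ℝ) • b i, ⟨z, rfl⟩, ?_⟩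
      rw [map_sum]
      refine Finset.sum_congr rfl fun k _ => ?_
      rw [map_smul, hb2, Int.cast_smul_eq_zsmul]
    obtain ⟨t, ht1, ht2⟩ := exists_between hvi
    have ht0 : 0 < t := lt_of_le_of_lt (norm_nonneg _) ht1
    have huU : u ∈ U i := by
      rcases cube_subset B ht0 u (fun j => by
        rw [← hL]
        exact (norm_le_pi_norm (L (Ξ u)) j).trans ht1.le) with h | h
      · exact Submodule.subset_span ⟨hu, t, ht0, ht2, h⟩
      · rw [← neg_neg u]
        exact Submodule.neg_mem _ (Submodule.subset_span ⟨neg_mem_latticeOf b u hu, t, ht0, ht2, h⟩)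
    rw [hΞ]
    have h1 := hwm i.rev
    have h2 : n - 1 - ((i.rev : Fin n) : ℕ) = i := by
      rw [Fin.val_rev]; have := i.2; omega
    simp only [h2] at h1
    exact Submodule.inner_left_of_mem_orthogonal huU h1)
  have e1 : ∏ i : Fin n, μ i = ∏ i : Fin n, succMin S Λ ((i : ℕ) + 1) :=
    Finset.prod_congr rfl fun i _ => hμ i
  rw [e1, ← abs_mul] at hcore
  have e2 : LinearMap.det (L : (Fin n → ℝ) →ₗ[ℝ] (Fin n → ℝ)) * (Matrix.of b2).det =
      (Matrix.of fun i j => B.symm (b i) j).det := by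
    have := Module.Basis.det_comp (Pi.basisFun ℝ (Fin n)) (L : (Fin n → ℝ) →ₗ[ℝ] (Fin n → ℝ)) b2
    rw [Pi.basisFun_det_apply, Pi.basisFun_det_apply] at this
    refine Eq.trans this.symm ?_
    congr 1
    ext i j
    simp only [Function.comp, Matrix.of_apply, LinearEquiv.coe_coe]
    rw [hb2, hL]
  have e3 : |(Matrix.of fun i j => B.symm (b i) j).det| = |LinearMap.det (mkLin fun i => B.symm (b i))| := by
    rw [det_mkLin, latticeDet, ← Matrix.det_transpose]
    rfl
  have e4 : mkLin b = (B : Euc n →ₗ[ℝ] Euc n) ∘ₗ mkLin fun i => B.symm (b i) := by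
    ext1 x
    simp [mkLin_apply]
  rw [e2, e3] at hcore
  rw [← det_mkLin b, e4, LinearMap.det_comp, abs_mul]
  gcongr

lemma succMin_Tn {n : ℕ} (i : Fin n) : succMin (Tn n) (stdLattice n) ((i : ℕ) + 1) = 1 := by
  have hT : Tn n = (LinearEquiv.refl ℝ (Euc n)) '' Tn n := (Set.image_id (Tn n)).symm
  have hi : (i : ℕ) + 1 ≤ n := i.2
  have h1 : (1 : ℝ) ∈ smSet (Tn n) (stdLattice n) ((i : ℕ) + 1) := by
    refine ⟨one_pos, fun k => EuclideanSpace.single (Fin.castLE hi k) (1 : ℝ), ?_, ?_⟩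
    · have := (EuclideanSpace.basisFun (Fin n) ℝ).toBasis.linearIndependent.comp _
        (Fin.castLE_injective hi)
      have e : (fun k => EuclideanSpace.single (Fin.castLE hi k) (1 : ℝ)) =
          (EuclideanSpace.basisFun (Fin n) ℝ).toBasis ∘ Fin.castLE hi := by
        funext k
        simp
      rw [e]
      exact this
    · intro k
      refine ⟨fun j => ?_, ?_⟩
      · by_cases h : j = Fin.castLE hi k
        · exact ⟨1, by simp [h]⟩
        · exact ⟨0, by simp [h]⟩
      · rw [one_smul, mem_Tn]
        refine ⟨fun j => ?_, by simp⟩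
        by_cases h : j = Fin.castLE hi k
        · subst h
          simp only [PiLp.single_apply]
          norm_num
        · simp [h]
  apply le_antisymm
  · exact csInf_le ⟨0, fun t ht => ht.1.le⟩ h1
  · refine le_csInf ⟨1, h1⟩ ?_
    rintro t ⟨ht, v, hv, hvm⟩
    by_contra hcon
    push Not at hcon
    obtain ⟨hz, hm⟩ := hvm 0
    rw [hT, mem_smul_image _ ht] at hm
    simp only [LinearEquiv.refl_symm, LinearEquiv.refl_apply] at hm
    choose z hz using hz
    have hz0 : ∀ j, 0 ≤ z j := by
      intro j
      have := hm.1 j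
      rw [hz] at this
      have h2 : (-1 : ℝ) < z j := by linarith
      have h3 : (-1 : ℤ) < z j := by exact_mod_cast h2
      omega
    have hsum : ∑ j, z j < 1 := by
      have h2 := hm.2
      simp only [hz] at h2
      have h3 : ((∑ j, z j : ℤ) : ℝ) < 1 := by push_cast; linarith
      exact_mod_cast h3
    apply hv.ne_zero 0
    ext j
    have h4 := Finset.single_le_sum (fun k _ => hz0 k) (Finset.mem_univ j)
    have h5 : z j = 0 := by have := hz0 j; omega
    rw [hz, h5]; simp

/-- **Proposition (Ehrhart's conjecture for simplices).** For an `n`-simplex `S` with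
centroid at the origin, `vol(S)/det Λ ≤ ((n+1)^n/n!)·∏ 1/λ_i(S,Λ)`; for `Λ = ℤ^n`
equality holds for `T_n`. -/
theorem statement9 {n : ℕ} (hn : 0 < n) (v : Fin (n + 1) → Euc n)
    (hv : AffineIndependent ℝ v) (S : Set (Euc n))
    (hS : S = convexHull ℝ (Set.range v)) (hcen : CentroidAtOrigin S)
    (b : Fin n → Euc n) (hb : LinearIndependent ℝ b) :
    (volume S).toReal / latticeDet b ≤
        (((n : ℝ) + 1) ^ n / n.factorial) *
          ∏ i : Fin n, (succMin S (latticeOf b) ((i : ℕ) + 1))⁻¹ ∧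
    (volume (Tn n)).toReal =
        (((n : ℝ) + 1) ^ n / n.factorial) *
          ∏ i : Fin n, (succMin (Tn n) (stdLattice n) ((i : ℕ) + 1))⁻¹ := by
  have hvT : (volume (Tn n)).toReal = ((n : ℝ) + 1) ^ n / n.factorial := by
    rw [vol_Tn, ENNReal.toReal_ofReal (by positivity)]
  constructor
  · obtain ⟨B₀, hB₀, hSB⟩ := exists_B v hv S hS hcen
    let B : Euc n ≃ₗ[ℝ] Euc n := LinearEquiv.ofInjectiveEndo B₀ hB₀
    have hBB : (B : Euc n →ₗ[ℝ] Euc n) = B₀ := by ext1 x; rfl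
    have hSB' : S = B '' Tn n := hSB
    obtain ⟨hpos, hmain⟩ := main_ineq_s9 hn B b hb
    rw [hBB, ← hSB'] at hmain
    rw [← hSB'] at hpos
    have hvol : (volume S).toReal = |LinearMap.det B₀| * (((n : ℝ) + 1) ^ n / n.factorial) := by
      rw [hSB, Measure.addHaar_image_linearMap, ENNReal.toReal_mul, hvT,
        ENNReal.toReal_ofReal (abs_nonneg _)]
    have hP : 0 < ∏ i : Fin n, succMin S (latticeOf b) ((i : ℕ) + 1) :=
      Finset.prod_pos fun i _ => hpos i
    have hdB : 0 < |LinearMap.det B₀| := by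
      rw [← hBB]
      exact abs_pos.mpr B.isUnit_det'.ne_zero
    have hdet : 0 < latticeDet b := lt_of_lt_of_le (by positivity) hmain
    rw [Finset.prod_inv_distrib, hvol, ← div_eq_mul_inv, div_le_div_iff₀ hdet hP]
    calc _ = (((n : ℝ) + 1) ^ n / n.factorial) *
          (|LinearMap.det B₀| * ∏ i : Fin n, succMin S (latticeOf b) ((i : ℕ) + 1)) := by ring
      _ ≤ _ := by gcongr
  · rw [hvT]
    simp [succMin_Tn]

end Paper
end
end

section
/- Let S = conv{v_0, v_1, …, v_n} ⊂ ℝ^n be an n-dimensional simplex with centroid at the origin (so v_0 = −Σ_{i=1}^n v_i), let H be the (n−1)-dimensional linear subspace parallel to the facet conv{v_1,…,v_n}, and let H^- be the closed halfspace bounded by H containing v_0. Then Π_H(S) ∩ H^- ⊆ (n/2)·S. -/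
open MeasureTheory Set Filter Pointwise RealInnerProductSpace
open scoped ENNReal

noncomputable section

namespace Paper

variable {n : ℕ}

/-- **Lemma (symmetral inclusion).** For a simplex `S = conv{v₀,…,v_n}` with centroid
at the origin, `Π_H(S) ∩ H⁻ ⊆ (n/2)·S`, where `H` is the hyperplane through the origin
parallel to the facet `conv{v₁,…,v_n}` and `H⁻` the halfspace containing `v₀`. -/
theorem statement10 {n : ℕ} (hn : 0 < n) (v₀ : Euc n) (v : Fin n → Euc n)
    (hind : LinearIndependent ℝ (fun i => v i - v₀))
    (hcen : v₀ + ∑ i, v i = 0)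
    (w : Fin n → Euc n)
    (hw : ∀ i, w i = ((1 : ℝ) / (n + 1)) • v₀ + ((n : ℝ) / (n + 1)) • v i)
    (PH : Set (Euc n))
    (hPH : PH = convexHull ℝ
      (Set.range fun ε : Fin n → Bool =>
        v₀ + ∑ i, (if ε i then (1 : ℝ) else 0) • (w i - v₀)))
    (PiH : Set (Euc n))
    (hPiH : PiH = (fun x => x + (((n : ℝ) - 2) / 2) • v₀) '' PH)
    (f : Euc n →ₗ[ℝ] ℝ) (hf : ∀ i j, f (v i) = f (v j)) (hfv : f v₀ < 0) :
    PiH ∩ {x | f x ≤ 0} ⊆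
      ((n : ℝ) / 2) • convexHull ℝ (insert v₀ (Set.range v)) := by
  have hn' : (0 : ℝ) < n := by exact_mod_cast hn
  have hn1 : (n : ℝ) + 1 ≠ 0 := by positivity
  have hsub : PH ⊆ {x | ∃ t : Fin n → ℝ, (∀ i, 0 ≤ t i) ∧
      x = v₀ + ∑ i, t i • (w i - v₀)} := by
    rw [hPH]
    apply convexHull_min
    · rintro _ ⟨ε, rfl⟩
      refine ⟨fun i => if ε i then (1 : ℝ) else 0, fun i => ?_, rfl⟩
      dsimp only
      split_ifs <;> norm_num
    · rintro _ ⟨s, hs, rfl⟩ _ ⟨t, ht, rfl⟩ a b ha hb hab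
      refine ⟨fun i => a * s i + b * t i, fun i => ?_, ?_⟩
      · have h1 := mul_nonneg ha (hs i)
        have h2 := mul_nonneg hb (ht i)
        exact add_nonneg h1 h2
      · simp only [add_smul, mul_smul, Finset.sum_add_distrib, ← Finset.smul_sum, smul_add]
        have : v₀ = a • v₀ + b • v₀ := by rw [← add_smul, hab, one_smul]
        generalize ∑ i, s i • (w i - v₀) = A
        generalize ∑ i, t i • (w i - v₀) = B
        calc a • v₀ + a • A + (b • v₀ + b • B) = (a • v₀ + b • v₀) + (a • A + b • B) := by abel
          _ = v₀ + (a • A + b • B) := by rw [← this]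
  rintro x ⟨hx, hfx⟩
  rw [hPiH] at hx
  obtain ⟨y, hy, rfl⟩ := hx
  obtain ⟨t, ht, rfl⟩ := hsub hy
  have hwv : ∀ i, w i - v₀ = ((n : ℝ) / (n + 1)) • (v i - v₀) := by
    intro i
    have : v₀ = ((1 : ℝ) / (n + 1)) • v₀ + ((n : ℝ) / (n + 1)) • v₀ := by
      rw [← add_smul, ← add_div, add_comm, div_self hn1, one_smul]
    rw [hw i, smul_sub]
    nth_rewrite 2 [this]
    abel
  obtain ⟨c, hc⟩ : ∃ c, ∀ i, f (v i) = c := ⟨f (v ⟨0, hn⟩), fun i => hf _ _⟩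
  have hf0 : f v₀ = - (n * c) := by
    have := congrArg f hcen
    simp [hc] at this
    linarith
  have hcpos : 0 < c := by
    rw [hf0] at hfv
    by_contra h
    push Not at h
    nlinarith
  have hsum : ∑ i, t i ≤ n / 2 := by
    have h : f (v₀ + ∑ i, t i • (w i - v₀) + (((n : ℝ) - 2) / 2) • v₀) ≤ 0 := hfx
    simp only [hwv, map_add, map_sum, map_smul, map_sub, hc, hf0, smul_eq_mul,
      ← Finset.sum_mul] at h
    have e : (n : ℝ) / (n + 1) * (c - -(n * c)) = n * c := by field_simp; ring
    rw [e] at h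
    have hp : 0 < n * c := by positivity
    by_contra hh
    push Not at hh
    nlinarith
  have hC := convex_convexHull ℝ (insert v₀ (Set.range v))
  refine ⟨(1 - ∑ i, 2 * t i / (n + 1)) • v₀ + ∑ i, (2 * t i / (n + 1)) • v i, ?_, ?_⟩
  · have key := hC.sum_mem (t := Finset.univ)
      (w := fun o : Option (Fin n) => o.elim (1 - ∑ i, 2 * t i / (n + 1))
        (fun i => 2 * t i / (n + 1)))
      (z := fun o : Option (Fin n) => o.elim v₀ v) ?_ ?_ ?_
    · simpa [Fintype.sum_option] using key
    · rintro (_ | i) -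
      · simp only [Option.elim]
        rw [← Finset.sum_div, ← Finset.mul_sum, sub_nonneg, div_le_one (by positivity)]
        linarith
      · have := ht i
        simp only [Option.elim]
        positivity
    · simp [Fintype.sum_option]
    · rintro (_ | i) -
      · exact subset_convexHull ℝ _ (Set.mem_insert _ _)
      · exact subset_convexHull ℝ _ (Set.mem_insert_of_mem _ ⟨i, rfl⟩)
  · have e1 : (1 - ∑ i, 2 * t i / ((n : ℝ) + 1)) • v₀ + ∑ i, (2 * t i / ((n : ℝ) + 1)) • v i
        = v₀ + ∑ i, (2 * t i / ((n : ℝ) + 1)) • (v i - v₀) := by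
      simp only [smul_sub, Finset.sum_sub_distrib, sub_smul, one_smul, Finset.sum_smul]
      abel
    have e2 : ∑ i, t i • (w i - v₀)
        = ((n : ℝ) / 2) • ∑ i, (2 * t i / ((n : ℝ) + 1)) • (v i - v₀) := by
      rw [Finset.smul_sum]
      refine Finset.sum_congr rfl fun i _ => ?_
      rw [hwv, smul_smul, smul_smul]
      congr 1
      field_simp
    dsimp only
    rw [e1, e2, smul_add]
    have e3 : ((n : ℝ) / 2) • v₀ = v₀ + (((n : ℝ) - 2) / 2) • v₀ := by
      nth_rewrite 2 [← one_smul ℝ v₀]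
      rw [← add_smul]
      congr 1
      ring
    rw [e3]
    abel

end Paper
end
end

section
/- Let Z ∈ ℤ^{n×n} be an integer matrix with det Z ≠ 0 and let α ∈ ℝ^n with ‖α‖ = 1. For ε ∈ {−1,1}^n write α_ε = (ε_1α_1, …, ε_nα_n). Then Σ_{ε ∈ {−1,1}^n} ‖Z α_ε‖ ≥ 2^n. Moreover, if all coordinates of α are positive, equality holds if and only if Z is, up to permutations of the columns and changes of signs of the columns, the identity matrix. -/
open MeasureTheory Set Filter Pointwise RealInnerProductSpace
open scoped ENNReal

noncomputable section

namespace Paper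

variable {n : ℕ}

/-- sign of a Boolean -/
def sg (b : Bool) : ℝ := if b then (1 : ℝ) else -1

lemma sg_sq (b : Bool) : sg b * sg b = 1 := by cases b <;> simp [sg]

lemma sg_not (b : Bool) : sg (!b) = - sg b := by cases b <;> simp [sg]

lemma sum_sg {n : ℕ} (i j : Fin n) :
    ∑ ε : Fin n → Bool, sg (ε i) * sg (ε j) = if i = j then (2 : ℝ) ^ n else 0 := by
  split_ifs with h
  · subst h
    simp [sg_sq]
  · refine Finset.sum_involution (fun ε _ => Function.update ε i (!ε i)) ?_ ?_ ?_ ?_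
    · intro ε _
      rw [Function.update_self, Function.update_of_ne (Ne.symm h), sg_not]
      ring
    · intro ε _ _ he
      have := congrFun he i
      simp at this
    · intro ε _
      exact Finset.mem_univ _
    · intro ε _
      simp

/-- the image vector -/
def vv {n : ℕ} (M : Matrix (Fin n) (Fin n) ℤ) (a : Fin n → ℝ) (ε : Fin n → Bool) (i : Fin n) : ℝ :=
  ∑ j, (M i j : ℝ) * (sg (ε j) * a j)

/-- its norm -/
def nn {n : ℕ} (M : Matrix (Fin n) (Fin n) ℤ) (a : Fin n → ℝ) (ε : Fin n → Bool) : ℝ :=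
  Real.sqrt (∑ i, vv M a ε i ^ 2)

lemma sum_vv {n : ℕ} (M : Matrix (Fin n) (Fin n) ℤ) (a : Fin n → ℝ) (i j : Fin n) :
    ∑ ε : Fin n → Bool, vv M a ε i * sg (ε j) = 2 ^ n * ((M i j : ℝ) * a j) := by
  unfold vv
  simp_rw [Finset.sum_mul]
  rw [Finset.sum_comm]
  have : ∀ k, ∑ ε : Fin n → Bool, (M i k : ℝ) * (sg (ε k) * a k) * sg (ε j)
      = (M i k : ℝ) * a k * (if k = j then (2 : ℝ) ^ n else 0) := by
    intro k
    rw [← sum_sg, Finset.mul_sum]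
    exact Finset.sum_congr rfl fun _ _ => by ring
  simp_rw [this]
  simp
  ring

lemma nn_nonneg {n : ℕ} (M : Matrix (Fin n) (Fin n) ℤ) (a : Fin n → ℝ) (ε : Fin n → Bool) :
    0 ≤ nn M a ε := Real.sqrt_nonneg _

lemma nn_sq {n : ℕ} (M : Matrix (Fin n) (Fin n) ℤ) (a : Fin n → ℝ) (ε : Fin n → Bool) :
    nn M a ε ^ 2 = ∑ i, vv M a ε i ^ 2 :=
  Real.sq_sqrt (Finset.sum_nonneg fun _ _ => sq_nonneg _)

lemma sgsq {n : ℕ} (a : Fin n → ℝ) (ε : Fin n → Bool) :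
    ∑ i, (sg (ε i) * a i) ^ 2 = ∑ i, a i ^ 2 := by
  refine Finset.sum_congr rfl fun i _ => ?_
  rw [mul_pow, pow_two (sg _), sg_sq, one_mul]

lemma cs {n : ℕ} (M : Matrix (Fin n) (Fin n) ℤ) (a : Fin n → ℝ) (ha : ∑ i, a i ^ 2 = 1)
    (ε : Fin n → Bool) : ∑ i, vv M a ε i * (sg (ε i) * a i) ≤ nn M a ε := by
  apply Real.le_sqrt_of_sq_le
  have := Finset.sum_mul_sq_le_sq_mul_sq Finset.univ (vv M a ε) (fun i => sg (ε i) * a i)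
  rwa [sgsq, ha, mul_one] at this

lemma sum_inner {n : ℕ} (M : Matrix (Fin n) (Fin n) ℤ) (a : Fin n → ℝ) :
    ∑ ε : Fin n → Bool, ∑ i, vv M a ε i * (sg (ε i) * a i)
      = 2 ^ n * ∑ i, (M i i : ℝ) * a i ^ 2 := by
  rw [Finset.sum_comm, Finset.mul_sum]
  refine Finset.sum_congr rfl fun i _ => ?_
  have := sum_vv M a i i
  calc _ = (∑ ε : Fin n → Bool, vv M a ε i * sg (ε i)) * a i := by
        rw [Finset.sum_mul]
        exact Finset.sum_congr rfl fun _ _ => by ring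
    _ = _ := by rw [this]; ring

lemma diag_le {n : ℕ} (M : Matrix (Fin n) (Fin n) ℤ) (hd : ∀ i, 1 ≤ M i i)
    (a : Fin n → ℝ) (ha : ∑ i, a i ^ 2 = 1) :
    (2 : ℝ) ^ n ≤ 2 ^ n * ∑ i, (M i i : ℝ) * a i ^ 2 := by
  have : (1 : ℝ) ≤ ∑ i, (M i i : ℝ) * a i ^ 2 := by
    rw [← ha]
    refine Finset.sum_le_sum fun i _ => ?_
    have h : (1 : ℝ) ≤ M i i := by exact_mod_cast hd i
    nlinarith [sq_nonneg (a i)]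
  have h2 : (0 : ℝ) < 2 ^ n := by positivity
  nlinarith

lemma ineq {n : ℕ} (M : Matrix (Fin n) (Fin n) ℤ) (hd : ∀ i, 1 ≤ M i i)
    (a : Fin n → ℝ) (ha : ∑ i, a i ^ 2 = 1) :
    (2 : ℝ) ^ n ≤ ∑ ε, nn M a ε :=
  (diag_le M hd a ha).trans ((sum_inner M a).symm.le.trans
    (Finset.sum_le_sum fun ε _ => cs M a ha ε))

lemma eq_case {n : ℕ} (M : Matrix (Fin n) (Fin n) ℤ) (hd : ∀ i, 1 ≤ M i i) (hM : M.det ≠ 0)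
    (a : Fin n → ℝ) (ha : ∑ i, a i ^ 2 = 1) (hp : ∀ i, 0 < a i)
    (he : ∑ ε, nn M a ε = (2 : ℝ) ^ n) : M = 1 := by
  have h1 := diag_le M hd a ha
  have h2 : ∑ ε : Fin n → Bool, ∑ i, vv M a ε i * (sg (ε i) * a i) ≤ ∑ ε, nn M a ε :=
    Finset.sum_le_sum fun ε _ => cs M a ha ε
  have h3 := sum_inner M a
  have hpn : (0 : ℝ) < 2 ^ n := by positivity
  -- diagonal
  have hdiag : ∀ i, M i i = 1 := by
    have hs : ∑ i, (M i i : ℝ) * a i ^ 2 = ∑ i, a i ^ 2 := by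
      rw [ha]
      have : (2 : ℝ) ^ n * ∑ i, (M i i : ℝ) * a i ^ 2 = 2 ^ n * 1 := by linarith
      exact mul_left_cancel₀ hpn.ne' this
    have := (Finset.sum_eq_sum_iff_of_le (s := Finset.univ)
      (f := fun i => a i ^ 2) (g := fun i => (M i i : ℝ) * a i ^ 2) (by
        intro i _
        have h : (1 : ℝ) ≤ M i i := by exact_mod_cast hd i
        nlinarith [sq_nonneg (a i)])).1 hs.symm
    intro i
    have h := this i (Finset.mem_univ i)
    have hh : (M i i : ℝ) = 1 := by
      have h0 : (a i ^ 2) ≠ 0 := (pow_pos (hp i) 2).ne'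
      apply mul_right_cancel₀ h0
      simpa using h.symm
    exact_mod_cast hh
  -- Cauchy-Schwarz equality
  have hcs : ∀ ε : Fin n → Bool, ∑ i, vv M a ε i * (sg (ε i) * a i) = nn M a ε := by
    have := (Finset.sum_eq_sum_iff_of_le (s := Finset.univ)
      (f := fun ε : Fin n → Bool => ∑ i, vv M a ε i * (sg (ε i) * a i)) (g := fun ε => nn M a ε)
      (fun ε _ => cs M a ha ε)).1 (by linarith)
    intro ε
    exact this ε (Finset.mem_univ ε)
  have hv : ∀ (ε : Fin n → Bool) i, vv M a ε i = nn M a ε * (sg (ε i) * a i) := by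
    intro ε
    have h0 : ∑ i, (vv M a ε i - nn M a ε * (sg (ε i) * a i)) ^ 2 = 0 := by
      have : ∀ i, (vv M a ε i - nn M a ε * (sg (ε i) * a i)) ^ 2
          = vv M a ε i ^ 2 - 2 * nn M a ε * (vv M a ε i * (sg (ε i) * a i))
            + nn M a ε ^ 2 * (sg (ε i) * a i) ^ 2 := fun i => by ring
      simp_rw [this]
      rw [Finset.sum_add_distrib, Finset.sum_sub_distrib, ← Finset.mul_sum, ← Finset.mul_sum,
        sgsq, ha, hcs, ← nn_sq]
      ring
    intro i
    have := (Finset.sum_eq_zero_iff_of_nonneg (fun i _ => sq_nonneg _)).1 h0 i (Finset.mem_univ i)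
    have := pow_eq_zero_iff (two_ne_zero) |>.1 this
    linarith
  ext i j
  by_cases hij : i = j
  · subst hij; simp [hdiag]
  rw [Matrix.one_apply_ne hij]
  -- positivity
  have hpos : ∀ ε : Fin n → Bool, 0 < nn M a ε := by
    intro ε
    refine lt_of_le_of_ne (nn_nonneg M a ε) (fun h => ?_)
    have hz : (M.map (Int.cast : ℤ → ℝ)).mulVec (fun j => sg (ε j) * a j) = 0 := by
      funext k
      have := hv ε k
      rw [← h, zero_mul] at this
      exact this
    have hdet : (M.map (Int.cast : ℤ → ℝ)).det ≠ 0 := by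
      have := Int.cast_det (R := ℝ) M
      rw [← this]
      exact_mod_cast hM
    have hx := Matrix.eq_zero_of_mulVec_eq_zero hdet hz
    have hxi := congrFun hx i
    have h1 := sg_sq (ε i)
    have h2 := hp i
    simp only [Pi.zero_apply, mul_eq_zero] at hxi
    rcases hxi with h | h
    · rw [h] at h1; norm_num at h1
    · exact h2.ne' h
  have hC : ∀ k l, (∑ ε : Fin n → Bool, nn M a ε * (sg (ε k) * sg (ε l))) * a k
      = 2 ^ n * ((M k l : ℝ) * a l) := by
    intro k l
    rw [← sum_vv, Finset.sum_mul]
    refine Finset.sum_congr rfl fun ε _ => ?_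
    rw [hv]; ring
  have c1 := hC i j
  have c2 := hC j i
  simp_rw [mul_comm (sg (_ : Bool)) (sg _)] at c2
  have hsym : (∑ ε : Fin n → Bool, nn M a ε * (sg (ε j) * sg (ε i)))
      = ∑ ε : Fin n → Bool, nn M a ε * (sg (ε i) * sg (ε j)) :=
    Finset.sum_congr rfl fun _ _ => by ring
  have c2 := hC j i
  rw [hsym] at c2
  set C := ∑ ε : Fin n → Bool, nn M a ε * (sg (ε i) * sg (ε j)) with hCdef
  have hup : C < 2 ^ n := by
    rw [← he]
    refine Finset.sum_lt_sum (fun ε _ => ?_) ⟨Function.update (fun _ => true) i false,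
      Finset.mem_univ _, ?_⟩
    · have := hpos ε
      cases ε i <;> cases ε j <;> simp [sg] <;> linarith
    · have := hpos (Function.update (fun _ => true) i false)
      rw [Function.update_self, Function.update_of_ne (Ne.symm hij)]
      simp [sg]; linarith
  have hlo : -C < 2 ^ n := by
    rw [← he, hCdef, ← Finset.sum_neg_distrib]
    refine Finset.sum_lt_sum (fun ε _ => ?_) ⟨fun _ => true, Finset.mem_univ _, ?_⟩
    · have := hpos ε
      cases ε i <;> cases ε j <;> simp [sg] <;> linarith
    · have := hpos (fun _ => true)
      simp [sg]; linarith
  have hpi := hp i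
  have hpj := hp j
  have hprod : C ^ 2 = (2 ^ n) ^ 2 * ((M i j * M j i : ℤ) : ℝ) := by
    have h0 : a i * a j ≠ 0 := (mul_pos hpi hpj).ne'
    apply mul_right_cancel₀ h0
    push_cast
    calc C ^ 2 * (a i * a j) = (C * a i) * (C * a j) := by ring
      _ = _ := by rw [c1, c2]; ring
  have hlt : C ^ 2 < (2 ^ n) ^ 2 := by nlinarith
  have hp2 : (0 : ℝ) < (2 ^ n) ^ 2 := by positivity
  have hm1 : M i j * M j i < 1 := by
    have : ((M i j * M j i : ℤ) : ℝ) < 1 := by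
      by_contra hcon
      push Not at hcon
      nlinarith
    exact_mod_cast this
  have hm2 : 0 ≤ M i j * M j i := by
    have : (0 : ℝ) ≤ ((M i j * M j i : ℤ) : ℝ) := by
      by_contra hcon
      push Not at hcon
      nlinarith [sq_nonneg C]
    exact_mod_cast this
  have hm : M i j * M j i = 0 := by omega
  rw [hm] at hprod
  have hC0 : C = 0 := by
    have : C ^ 2 = 0 := by simpa using hprod
    exact pow_eq_zero_iff two_ne_zero |>.1 this
  rw [hC0, zero_mul] at c1
  have : (M i j : ℝ) = 0 := by
    rcases mul_eq_zero.1 c1.symm with h | h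
    · exact absurd h hpn.ne'
    · rcases mul_eq_zero.1 h with h | h
      · exact h
      · exact absurd h hpj.ne'
  exact_mod_cast this

lemma exists_perm {n : ℕ} (Z : Matrix (Fin n) (Fin n) ℤ) (hZ : Z.det ≠ 0) :
    ∃ τ : Equiv.Perm (Fin n), ∀ i, Z (τ i) i ≠ 0 := by
  by_contra hcon
  push Not at hcon
  apply hZ
  rw [Matrix.det_apply]
  refine Finset.sum_eq_zero fun τ _ => ?_
  obtain ⟨i, hi⟩ := hcon τ
  have h0 : ∏ i, Z (τ i) i = 0 := Finset.prod_eq_zero (f := fun i => Z (τ i) i) (Finset.mem_univ i) hi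
  rw [h0, smul_zero]

/-- **Lemma (matrix inequality).** For an integer matrix `Z` with `det Z ≠ 0` and a unit
vector `α`, `∑_{ε ∈ {±1}^n} ‖Z α_ε‖ ≥ 2^n`; for `α > 0`, equality holds iff `Z` is the
identity matrix up to column permutations and signs. -/
theorem statement11 {n : ℕ} (Z : Matrix (Fin n) (Fin n) ℤ) (hZ : Z.det ≠ 0)
    (α : Euc n) (hα : ‖α‖ = 1) :
    (2 : ℝ) ^ n ≤
        ∑ ε : Fin n → Bool,
          ‖(show Euc n from
            WithLp.toLp 2 ((Z.map (Int.cast : ℤ → ℝ)).mulVec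
              (fun i => (if ε i then (1 : ℝ) else -1) * α i)))‖ ∧
    ((∀ i, 0 < α i) →
      ((∑ ε : Fin n → Bool,
          ‖(show Euc n from
            WithLp.toLp 2 ((Z.map (Int.cast : ℤ → ℝ)).mulVec
              (fun i => (if ε i then (1 : ℝ) else -1) * α i)))‖) = (2 : ℝ) ^ n ↔
        ∃ (σ : Equiv.Perm (Fin n)) (δ : Fin n → ℤ),
          (∀ i, δ i = 1 ∨ δ i = -1) ∧
          ∀ i j, Z j i = if j = σ i then δ i else 0)) := by
  have ha : ∑ i, α i ^ 2 = 1 := by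
    have := EuclideanSpace.real_norm_sq_eq α
    rw [hα] at this
    linarith
  have hnorm : ∀ ε : Fin n → Bool, ‖(show Euc n from
            WithLp.toLp 2 ((Z.map (Int.cast : ℤ → ℝ)).mulVec
              (fun i => (if ε i then (1 : ℝ) else -1) * α i)))‖ = nn Z α ε := by
    intro ε
    rw [EuclideanSpace.norm_eq]
    simp only [Real.norm_eq_abs, sq_abs]
    rfl
  simp_rw [hnorm]
  obtain ⟨τ, hτ⟩ := exists_perm Z hZ
  set s : Fin n → ℤ := fun i => (Z (τ i) i).sign with hs
  have hs1 : ∀ i, s i = 1 ∨ s i = -1 := by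
    intro i
    rcases lt_or_gt_of_ne (hτ i) with h | h
    · right; exact Int.sign_eq_neg_one_of_neg h
    · left; exact Int.sign_eq_one_of_pos h
  have hss : ∀ i, s i * s i = 1 := fun i => by rcases hs1 i with h | h <;> simp [h]
  let M : Matrix (Fin n) (Fin n) ℤ := Matrix.of fun i j => s i * Z (τ i) j
  have hMdef : ∀ i j, M i j = s i * Z (τ i) j := fun _ _ => rfl
  have hd : ∀ i, 1 ≤ M i i := by
    intro i
    rw [hMdef, Int.sign_mul_self_eq_abs]
    exact Int.one_le_abs (hτ i)
  have hMdet : M.det ≠ 0 := by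
    have h1 : M = Matrix.diagonal s * Z.submatrix τ id := by
      ext i j
      rw [Matrix.diagonal_mul]; rfl
    rw [h1, Matrix.det_mul, Matrix.det_diagonal, Matrix.det_permute]
    refine mul_ne_zero (Finset.prod_ne_zero_iff.2 fun i _ => ?_) (mul_ne_zero ?_ hZ)
    · rcases hs1 i with h | h <;> simp [h]
    · simp
  have hMZ : ∀ ε, nn M α ε = nn Z α ε := by
    intro ε
    unfold nn
    congr 1
    rw [← Equiv.sum_comp τ (fun i => vv Z α ε i ^ 2)]
    refine Finset.sum_congr rfl fun i _ => ?_
    have : vv M α ε i = s i * vv Z α ε (τ i) := by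
      unfold vv
      rw [Finset.mul_sum]
      refine Finset.sum_congr rfl fun j _ => ?_
      rw [hMdef]; push_cast; ring
    rw [this, mul_pow]
    have : ((s i : ℤ) : ℝ) ^ 2 = 1 := by
      have := hss i
      rw [pow_two]; exact_mod_cast this
    rw [this, one_mul]
  simp_rw [← hMZ]
  refine ⟨ineq M hd α ha, fun hp => ⟨fun he => ?_, ?_⟩⟩
  · have h1 := eq_case M hd hMdet α ha hp he
    refine ⟨τ, s, hs1, fun i j => ?_⟩
    obtain ⟨k, rfl⟩ := τ.surjective j
    have h2 : s k * Z (τ k) i = (1 : Matrix (Fin n) (Fin n) ℤ) k i := by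
      rw [← hMdef, h1]
    have h3 : Z (τ k) i = s k * (1 : Matrix (Fin n) (Fin n) ℤ) k i := by
      rw [← h2, ← mul_assoc, hss, one_mul]
    rw [h3, Matrix.one_apply]
    by_cases hk : k = i
    · subst hk; simp
    · simp [hk]
  · rintro ⟨σ, δ, hδ, hZσ⟩
    simp_rw [hMZ]
    have : ∀ ε, nn Z α ε = 1 := by
      intro ε
      unfold nn
      rw [← Equiv.sum_comp σ, Real.sqrt_eq_one, ← ha, ← sgsq α ε]
      refine Finset.sum_congr rfl fun i _ => ?_
      have : vv Z α ε (σ i) = δ i * (sg (ε i) * α i) := by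
        unfold vv
        rw [Finset.sum_eq_single i]
        · simp [hZσ]
        · intro j _ hj
          simp [hZσ, Ne.symm hj]
        · simp
      rw [this, mul_pow]
      have : ((δ i : ℤ) : ℝ) ^ 2 = 1 := by rcases hδ i with h | h <;> simp [h]
      rw [this, one_mul]
    simp [this]

end Paper
end
end
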